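/- Let t ≥ 1, let P_1, ..., P_t ∈ ℤ[y] be polynomials with 0 < deg P_1 < ... < deg P_t, and let v_1, ..., v_t ∈ ℤ^D be nonzero vectors. There exists c > 0 and p_0 such that for all primes p > p_0 and all nonnegative 1-bounded functions f: F_p^D → ℝ, E_{x ∈ F_p^D, y ∈ F_p} f(x) ∏_{i=1}^{t} f(x + v_i P_i(y)) ≥ (E_{x ∈ F_p^D} f(x))^{t+1} + O(p^{−c}). -/

import Mathlib

open Finset Complex

noncomputable def avg {α : Type*} [Fintype α] (f : α → ℂ) : ℂ :=
  (∑ x, f x) / (Fintype.card α : ℂ)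

noncomputable def avgR {α : Type*} [Fintype α] (f : α → ℝ) : ℝ :=
  (∑ x, f x) / (Fintype.card α : ℝ)

noncomputable def ep (p : ℕ) [NeZero p] (x : ZMod p) : ℂ :=
  Complex.exp (2 * Real.pi * Complex.I * (x.val : ℂ) / (p : ℂ))

noncomputable def conjIt (n : ℕ) (z : ℂ) : ℂ :=
  (fun w : ℂ => (starRingEnd ℂ) w)^[n] z

/-- `2^s`-th power of the Gowers norm of degree `s` along the vector `v`. -/
noncomputable def gowersPow {p D : ℕ} [NeZero p] (s : ℕ) (v : Fin D → ZMod p)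
    (f : (Fin D → ZMod p) → ℂ) : ℂ :=
  avg fun xh : (Fin D → ZMod p) × (Fin s → ZMod p) =>
    ∏ w : Fin s → Bool,
      conjIt (Finset.univ.filter (fun i => w i = true)).card
        (f (xh.1 + (∑ i, if w i then xh.2 i else 0) • v))

/-- `2^s`-th power of the one-dimensional Gowers norm of degree `s` on `F_p`. -/
noncomputable def gowersPow1 {p : ℕ} [NeZero p] (s : ℕ) (g : ZMod p → ℂ) : ℂ :=
  avg fun xh : ZMod p × (Fin s → ZMod p) =>
    ∏ w : Fin s → Bool,
      conjIt (Finset.univ.filter (fun i => w i = true)).card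
        (g (xh.1 + ∑ i, if w i then xh.2 i else 0))

/-- Fourier transform of `f` along `v`. -/
noncomputable def ft {p D : ℕ} [NeZero p] (f : (Fin D → ZMod p) → ℂ)
    (v : Fin D → ZMod p) (x : Fin D → ZMod p) (k : ZMod p) : ℂ :=
  avg fun m : ZMod p => f (x + m • v) * ep p (-(k * m))

namespace PolyConfig

open scoped BigOperators ComplexConjugate

/-! ### Averages over finite types -/

section Averages

variable {α β : Type*} [Fintype α] [Fintype β]

lemma pow_expect_le [Nonempty α] (f : α → ℝ) (hf : ∀ a, 0 ≤ f a) (n : ℕ) :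
    (𝔼 a, f a) ^ n ≤ 𝔼 a, f a ^ n := by
  have h := Real.pow_arith_mean_le_arith_mean_pow (univ : Finset α)
    (fun _ => (Fintype.card α : ℝ)⁻¹) f (fun _ _ => by positivity)
    (by simp) (fun a _ => hf a) n
  rw [Fintype.expect_eq_sum_div_card, Fintype.expect_eq_sum_div_card, div_eq_inv_mul,
    div_eq_inv_mul, Finset.mul_sum, Finset.mul_sum]
  exact h

lemma norm_expect_pow_le [Nonempty α] (f : α → ℂ) (n : ℕ) :
    ‖𝔼 a, f a‖ ^ n ≤ 𝔼 a, ‖f a‖ ^ n :=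
  (pow_le_pow_left₀ (norm_nonneg _) (RCLike.norm_expect_le (K := ℂ)) n).trans
    (pow_expect_le _ (fun _ => norm_nonneg _) n)

lemma norm_expect_le_one [Nonempty α] {f : α → ℂ} (hf : ∀ a, ‖f a‖ ≤ 1) : ‖𝔼 a, f a‖ ≤ 1 :=
  (RCLike.norm_expect_le (K := ℂ)).trans (Finset.expect_le univ_nonempty fun a _ => hf a)

lemma expect_congr' {f g : α → ℂ} (h : ∀ a, f a = g a) : 𝔼 a, f a = 𝔼 a, g a :=
  Finset.expect_congr rfl fun a _ => h a

lemma expect_add_right {G : Type*} [AddCommGroup G] [Fintype G] {M : Type*} [AddCommMonoid M]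
    [Module ℚ≥0 M] (f : G → M) (a : G) : 𝔼 x, f (x + a) = 𝔼 x, f x :=
  Fintype.expect_equiv (Equiv.addRight a) _ _ fun _ => rfl

lemma conj_expect (f : α → ℂ) : conj (𝔼 a, f a) = 𝔼 a, conj (f a) := by
  simp [Fintype.expect_eq_sum_div_card, map_sum, map_div₀]

lemma norm_expect_sq (f : α → ℂ) :
    ((‖𝔼 a, f a‖ ^ 2 : ℝ) : ℂ) = 𝔼 a, 𝔼 b, f a * conj (f b) := by
  rw [← Finset.expect_mul_expect, ← conj_expect, Complex.mul_conj, Complex.normSq_eq_norm_sq]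

lemma ofReal_expect (f : α → ℝ) : ((𝔼 a, f a : ℝ) : ℂ) = 𝔼 a, (f a : ℂ) :=
  RCLike.ofReal_expect (K := ℂ) _ _

/-- Cauchy–Schwarz with a bounded weight. -/
lemma norm_expect_mul_sq_le [Nonempty α] (b f : α → ℂ) (hb : ∀ a, ‖b a‖ ≤ 1) :
    ‖𝔼 a, b a * f a‖ ^ 2 ≤ 𝔼 a, ‖f a‖ ^ 2 := by
  refine (norm_expect_pow_le _ 2).trans (Finset.expect_le_expect fun a _ => ?_)
  rw [norm_mul]
  exact pow_le_pow_left₀ (by positivity)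
    (mul_le_of_le_one_left (norm_nonneg _) (hb a)) 2

/-- Van der Corput: Cauchy–Schwarz followed by expansion of the square over a group. -/
lemma norm_expect_expect_sq_le {G : Type*} [AddCommGroup G] [Fintype G] [Nonempty α]
    (b : α → ℂ) (f : α → G → ℂ) (hb : ∀ a, ‖b a‖ ≤ 1) :
    ‖𝔼 a, 𝔼 y, b a * f a y‖ ^ 2 ≤ 𝔼 h : G, ‖𝔼 a, 𝔼 y, f a y * conj (f a (y + h))‖ := by
  have h1 : ‖𝔼 a, 𝔼 y, b a * f a y‖ ^ 2 ≤ 𝔼 a, ‖𝔼 y, f a y‖ ^ 2 := by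
    simp_rw [← Finset.mul_expect]
    exact norm_expect_mul_sq_le _ _ hb
  have h2 : ((𝔼 a, ‖𝔼 y, f a y‖ ^ 2 : ℝ) : ℂ)
      = 𝔼 h : G, 𝔼 a, 𝔼 y, f a y * conj (f a (y + h)) := by
    rw [ofReal_expect, Finset.expect_comm]
    refine expect_congr' fun a => ?_
    calc ((‖𝔼 y, f a y‖ ^ 2 : ℝ) : ℂ) = 𝔼 y, 𝔼 z, f a y * conj (f a z) := norm_expect_sq _
      _ = 𝔼 y, 𝔼 h, f a y * conj (f a (y + h)) := expect_congr' fun y => by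
          rw [← expect_add_right _ y]
          exact expect_congr' fun h => by rw [add_comm]
      _ = _ := Finset.expect_comm _ _ _
  calc _ ≤ _ := h1
    _ = ‖((𝔼 a, ‖𝔼 y, f a y‖ ^ 2 : ℝ) : ℂ)‖ := by
        rw [Complex.norm_real, Real.norm_of_nonneg]
        exact Finset.expect_nonneg fun _ _ => by positivity
    _ ≤ _ := by rw [h2]; exact RCLike.norm_expect_le (K := ℂ)

lemma expect_prod_type {M : Type*} [AddCommMonoid M] [Module ℚ≥0 M] (f : α × β → M) :
    𝔼 z, f z = 𝔼 a, 𝔼 b, f (a, b) := by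
  rw [← Finset.univ_product_univ, Finset.expect_product]

lemma expect_sum_arrow {H₁ H₂ : Type*} [Fintype H₁] [Fintype H₂] [DecidableEq H₁]
    [DecidableEq H₂] (f : (H₁ ⊕ H₂ → α) → ℝ) :
    𝔼 h, f h = 𝔼 h₁, 𝔼 h₂, f (Sum.elim h₁ h₂) := by
  rw [← expect_prod_type (fun z : (H₁ → α) × (H₂ → α) => f (Sum.elim z.1 z.2))]
  exact Fintype.expect_equiv (Equiv.sumArrowEquivProdArrow H₁ H₂ α) _ _ fun h => by
    congr 1; ext i; cases i <;> rfl

lemma expect_fin_cons {M : Type*} [AddCommMonoid M] [Module ℚ≥0 M] {k : ℕ}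
    (f : (Fin (k + 1) → α) → M) :
    𝔼 h, f h = 𝔼 l, 𝔼 h : Fin k → α, f (Fin.cons l h) := by
  rw [← expect_prod_type (fun z : α × (Fin k → α) => f (Fin.cons z.1 z.2))]
  exact Fintype.expect_equiv (Fin.consEquiv fun _ => α).symm _ _ fun h => by
    simp [Fin.consEquiv]

end Averages

/-! ### The additive character -/

section Character

variable {p : ℕ} [Fact p.Prime]

/-- The standard additive character of `ZMod p`. -/
noncomputable abbrev ec : AddChar (ZMod p) ℂ := ZMod.stdAddChar

lemma norm_ec (x : ZMod p) : ‖ec x‖ = 1 := by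
  rw [ec, ZMod.stdAddChar_apply]; exact Circle.norm_coe _

lemma conj_ec (x : ZMod p) : conj (ec x) = ec (-x) := by
  rw [AddChar.map_neg_eq_conj]

lemma ec_sum {ι : Type*} (s : Finset ι) (a : ι → ZMod p) :
    ec (∑ i ∈ s, a i) = ∏ i ∈ s, ec (a i) := by
  classical
  induction s using Finset.induction_on with
  | empty => simp
  | insert i s hi ih => rw [Finset.sum_insert hi, Finset.prod_insert hi, AddChar.map_add_eq_mul, ih]

lemma expect_ec_mul (a : ZMod p) : 𝔼 y : ZMod p, ec (y * a) = if a = 0 then 1 else 0 := by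
  rw [Fintype.expect_eq_sum_div_card, AddChar.sum_mulShift a (ZMod.isPrimitive_stdAddChar p)]
  split_ifs with h
  · exact div_self (by simp [NeZero.ne])
  · simp

end Character

/-! ### Negative powers of `p` -/

section Decay

variable {p : ℕ} [Fact p.Prime]

lemma one_le_prime : (1 : ℝ) ≤ p := by exact_mod_cast (Fact.out : p.Prime).one_lt.le

lemma decay_pos (c : ℝ) : 0 < (p : ℝ) ^ (-c) :=
  Real.rpow_pos_of_pos (zero_lt_one.trans_le one_le_prime) _

lemma decay_anti {c c' : ℝ} (h : c' ≤ c) : (p : ℝ) ^ (-c) ≤ (p : ℝ) ^ (-c') :=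
  Real.rpow_le_rpow_of_exponent_le one_le_prime (neg_le_neg h)

lemma le_decay_of_pow_le {x K c : ℝ} {n : ℕ} (hn : n ≠ 0)
    (h : x ^ n ≤ K * (p : ℝ) ^ (-c)) : x ≤ max K 1 * (p : ℝ) ^ (-(c / n)) := by
  refine le_of_pow_le_pow_left₀ hn (mul_nonneg (by positivity) (decay_pos _).le) (h.trans ?_)
  rw [mul_pow, ← Real.rpow_natCast ((p : ℝ) ^ _), ← Real.rpow_mul (by positivity)]
  have : -(c / n) * (n : ℝ) = -c := by field_simp
  rw [this]
  refine mul_le_mul_of_nonneg_right ?_ (decay_pos _).le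
  exact (le_max_left K 1).trans (le_self_pow₀ (le_max_right _ _) hn)

lemma decay_add_le {x y z K K' c c' : ℝ} (hK : 0 ≤ K) (hK' : 0 ≤ K') (h : z ≤ x + y)
    (hx : x ≤ K * (p : ℝ) ^ (-c)) (hy : y ≤ K' * (p : ℝ) ^ (-c')) :
    z ≤ (K + K') * (p : ℝ) ^ (-(min c c')) := by
  have h1 := mul_le_mul_of_nonneg_left (decay_anti (p := p) (min_le_left c c')) hK
  have h2 := mul_le_mul_of_nonneg_left (decay_anti (p := p) (min_le_right c c')) hK'
  linarith

end Decay

open Polynomial (taylor natDegree)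

/-! ### Discrete cubes -/

section Cube

variable {H H₁ H₂ : Type} [Fintype H] [Fintype H₁] [Fintype H₂] {p : ℕ} [Fact p.Prime]

/-- The sum of those `h i` for which `ω i` is true. -/
def dot (ω : H → Bool) (h : H → ZMod p) : ZMod p := ∑ i, if ω i then h i else 0

/-- Complex conjugation, applied once for each true coordinate of `ω`. -/
noncomputable def cj (ω : H → Bool) : ℂ →+* ℂ := starRingEnd ℂ ^ (∑ i, (ω i).toNat)

lemma norm_cj (ω : H → Bool) (z : ℂ) : ‖cj ω z‖ = ‖z‖ := by
  unfold cj
  induction ∑ i, (ω i).toNat with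
  | zero => simp
  | succ n ih => rw [pow_succ', RingHom.mul_def, RingHom.comp_apply, Complex.norm_conj, ih]

lemma cj_conj (ω : H → Bool) (z : ℂ) : cj ω (conj z) = conj (cj ω z) := by
  unfold cj
  exact congrArg (fun f : ℂ →+* ℂ => f z) (pow_mul_comm' (starRingEnd ℂ) _)

lemma dot_sumElim (ω : H₁ ⊕ H₂ → Bool) (h₁ : H₁ → ZMod p) (h₂ : H₂ → ZMod p) :
    dot ω (Sum.elim h₁ h₂) = dot (ω ∘ Sum.inl) h₁ + dot (ω ∘ Sum.inr) h₂ := by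
  simp [dot, Fintype.sum_sum_type]

lemma cj_sum (ω : H₁ ⊕ H₂ → Bool) (z : ℂ) :
    cj ω z = cj (ω ∘ Sum.inr) (cj (ω ∘ Sum.inl) z) := by
  simp only [cj, Fintype.sum_sum_type, Function.comp_apply]
  rw [add_comm, pow_add, RingHom.mul_def, RingHom.comp_apply]

lemma dot_cons {k : ℕ} (b : Bool) (ω : Fin k → Bool) (l : ZMod p) (h : Fin k → ZMod p) :
    dot (Fin.cons b ω : Fin (k + 1) → Bool) (Fin.cons l h : Fin (k + 1) → ZMod p)
      = (if b then l else 0) + dot ω h := by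
  simp [dot, Fin.sum_univ_succ]

lemma cj_cons_false {k : ℕ} (ω : Fin k → Bool) :
    cj (Fin.cons false ω : Fin (k + 1) → Bool) = cj ω := by
  simp [cj, Fin.sum_univ_succ]

lemma cj_cons_true {k : ℕ} (ω : Fin k → Bool) (z : ℂ) :
    cj (Fin.cons true ω : Fin (k + 1) → Bool) z = cj ω (conj z) := by
  simp only [cj, Fin.sum_univ_succ, Fin.cons_zero, Fin.cons_succ, Bool.toNat_true]
  rw [add_comm, pow_succ, RingHom.mul_def, RingHom.comp_apply]

lemma prod_fin_cons_bool {k : ℕ} (F : (Fin (k + 1) → Bool) → ℂ) :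
    ∏ ω, F ω = ∏ ω : Fin k → Bool, (F (Fin.cons false ω) * F (Fin.cons true ω)) := by
  rw [← (Fin.consEquiv fun _ : Fin (k + 1) => Bool).prod_comp, Fintype.prod_prod_type,
    Fintype.prod_bool, ← Finset.prod_mul_distrib]
  exact Finset.prod_congr rfl fun ω _ => mul_comm _ _

lemma prod_sum_bool [DecidableEq H₁] [DecidableEq H₂] (F : (H₁ ⊕ H₂ → Bool) → ℂ) :
    ∏ ω, F ω = ∏ ω₂, ∏ ω₁, F (Sum.elim ω₁ ω₂) := by
  rw [← (Equiv.sumArrowEquivProdArrow H₁ H₂ Bool).symm.prod_comp, Fintype.prod_prod_type,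
    Finset.prod_comm]
  rfl

lemma prod_norm_le_one {ι : Type*} (s : Finset ι) {f : ι → ℂ} (hf : ∀ i, ‖f i‖ ≤ 1) :
    ‖∏ i ∈ s, f i‖ ≤ 1 := by
  rw [norm_prod]
  exact Finset.prod_le_one (fun _ _ => norm_nonneg _) fun i _ => hf i

end Cube

/-! ### Functions that behave like polynomial phases in the second variable -/

section Phase

variable {p : ℕ} [Fact p.Prime] {X Y : Type*}

/-- Bounded functions of `(x, y)` that do not depend on `y` after `d` multiplicative
differencings in `y`. -/
def IsPhase : ℕ → (X → ZMod p → ℂ) → Prop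
  | 0, A => (∀ x y, ‖A x y‖ ≤ 1) ∧ ∀ x y y', A x y = A x y'
  | d + 1, A => (∀ x y, ‖A x y‖ ≤ 1) ∧ ∀ h, IsPhase d fun x y => A x y * conj (A x (y + h))

lemma IsPhase.norm_le {d : ℕ} {A : X → ZMod p → ℂ} (hA : IsPhase d A) (x : X) (y : ZMod p) :
    ‖A x y‖ ≤ 1 := by
  cases d <;> exact hA.1 x y

lemma norm_mul_le_one {a b : ℂ} (ha : ‖a‖ ≤ 1) (hb : ‖b‖ ≤ 1) : ‖a * b‖ ≤ 1 := by
  rw [norm_mul]; exact mul_le_one₀ ha (norm_nonneg _) hb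

lemma IsPhase.of_const (d : ℕ) {f : X → ℂ} (hf : ∀ x, ‖f x‖ ≤ 1) :
    IsPhase (p := p) d fun x _ => f x := by
  induction d generalizing f with
  | zero => exact ⟨fun x _ => hf x, fun _ _ _ => rfl⟩
  | succ d ih =>
    exact ⟨fun x _ => hf x, fun _ => ih fun x => norm_mul_le_one (hf x) (by simpa using hf x)⟩

lemma IsPhase.mul {d : ℕ} {A B : X → ZMod p → ℂ} (hA : IsPhase d A) (hB : IsPhase d B) :
    IsPhase d fun x y => A x y * B x y := by
  induction d generalizing A B with
  | zero =>
    exact ⟨fun x y => norm_mul_le_one (hA.1 x y) (hB.1 x y),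
      fun x y y' => by beta_reduce; rw [hA.2 x y y', hB.2 x y y']⟩
  | succ d ih =>
    refine ⟨fun x y => norm_mul_le_one (hA.1 x y) (hB.1 x y), fun h => ?_⟩
    convert ih (hA.2 h) (hB.2 h) using 3
    rw [map_mul]; ring

lemma IsPhase.prod {d : ℕ} {ι : Type*} (s : Finset ι) {A : ι → X → ZMod p → ℂ}
    (hA : ∀ i, IsPhase d (A i)) : IsPhase d fun x y => ∏ i ∈ s, A i x y := by
  classical
  induction s using Finset.induction_on with
  | empty => simpa using IsPhase.of_const d (f := fun _ : X => (1 : ℂ)) (by simp)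
  | insert i s hi ih =>
    simp_rw [Finset.prod_insert hi]
    exact (hA i).mul ih

lemma IsPhase.shift {d : ℕ} {A : X → ZMod p → ℂ} (hA : IsPhase d A) (t : ZMod p) :
    IsPhase d fun x y => A x (y + t) := by
  induction d generalizing A with
  | zero => exact ⟨fun x y => hA.1 x _, fun x y y' => hA.2 x _ _⟩
  | succ d ih =>
    refine ⟨fun x y => hA.1 x _, fun h => ?_⟩
    simp_rw [add_right_comm _ h t]
    exact ih (hA.2 h)

lemma IsPhase.comp {d : ℕ} {A : X → ZMod p → ℂ} (hA : IsPhase d A) (σ : Y → X) :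
    IsPhase d fun x y => A (σ x) y := by
  induction d generalizing A with
  | zero => exact ⟨fun x y => hA.1 _ _, fun x y y' => hA.2 _ _ _⟩
  | succ d ih => exact ⟨fun x y => hA.1 _ _, fun h => ih (hA.2 h)⟩

lemma IsPhase.cj {H : Type} [Fintype H] {d : ℕ} {A : X → ZMod p → ℂ} (hA : IsPhase d A)
    (ω : H → Bool) : IsPhase d fun x y => cj ω (A x y) := by
  induction d generalizing A with
  | zero => exact ⟨fun x y => (norm_cj _ _).trans_le (hA.1 _ _),
      fun x y y' => by beta_reduce; rw [hA.2 x y y']⟩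
  | succ d ih =>
    refine ⟨fun x y => (norm_cj _ _).trans_le (hA.1 _ _), fun h => ?_⟩
    convert ih (hA.2 h) using 3
    rw [map_mul, cj_conj]

lemma natDegree_sub_taylor_le {S : Type*} [CommRing S] {d : ℕ} {q : Polynomial S}
    (hq : q.natDegree ≤ d + 1) (t : S) : (q - taylor t q).natDegree ≤ d := by
  rw [Polynomial.natDegree_le_iff_coeff_eq_zero]
  intro n hn
  rw [Polynomial.coeff_sub]
  rcases (Nat.succ_le_of_lt hn).eq_or_lt with rfl | hlt
  · rcases hq.eq_or_lt with h | h
    · have h1 := Polynomial.coeff_taylor_natDegree (r := t) (f := q)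
      rw [h] at h1
      rw [h1, Polynomial.leadingCoeff, h, sub_self]
    · rw [Polynomial.coeff_eq_zero_of_natDegree_lt h, Polynomial.coeff_eq_zero_of_natDegree_lt
        (by rwa [Polynomial.natDegree_taylor]), sub_self]
  · have h : q.natDegree < n := lt_of_le_of_lt hq hlt
    rw [Polynomial.coeff_eq_zero_of_natDegree_lt h, Polynomial.coeff_eq_zero_of_natDegree_lt
        (by rwa [Polynomial.natDegree_taylor]), sub_self]

lemma IsPhase.of_polynomial (d : ℕ) {f : X → ℂ} (hf : ∀ x, ‖f x‖ ≤ 1)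
    {Q : X → Polynomial (ZMod p)} (hQ : ∀ x, (Q x).natDegree ≤ d) :
    IsPhase d fun x y => f x * ec ((Q x).eval y) := by
  have hb : ∀ x y, ‖f x * ec ((Q x).eval y)‖ ≤ 1 := fun x y => by
    rw [norm_mul, norm_ec, mul_one]; exact hf x
  induction d generalizing f Q with
  | zero =>
    refine ⟨hb, fun x y y' => ?_⟩
    beta_reduce
    rw [Polynomial.eq_C_of_natDegree_le_zero (hQ x)]
    simp
  | succ d ih =>
    refine ⟨hb, fun h => ?_⟩
    have hf' : ∀ x, ‖f x * conj (f x)‖ ≤ 1 := fun x =>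
      norm_mul_le_one (hf x) (by simpa using hf x)
    have hQ' := fun x => natDegree_sub_taylor_le (hQ x) h
    convert ih hf' hQ' (fun x y => by
      rw [norm_mul, norm_ec, mul_one]; exact hf' x) using 3
    rename_i x y
    rw [map_mul, conj_ec, Polynomial.eval_sub, Polynomial.taylor_eval, sub_eq_add_neg,
      AddChar.map_add_eq_mul]
    ring

lemma prod_cube_cons {k : ℕ} (B : X → ZMod p → ℂ) (l : ZMod p) (h : Fin k → ZMod p) (x : X)
    (y : ZMod p) :
    ∏ ω, PolyConfig.cj ω (B x (y + dot ω (Fin.cons l h : Fin (k + 1) → ZMod p)))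
      = ∏ ω, PolyConfig.cj ω (B x (y + dot ω h) * conj (B x (y + dot ω h + l))) := by
  rw [prod_fin_cons_bool]
  refine Finset.prod_congr rfl fun ω _ => ?_
  rw [cj_cons_false, cj_cons_true, dot_cons, dot_cons, map_mul, add_assoc y, add_comm (dot ω h) l]
  simp

variable [Fintype X] [Nonempty X]

/-- Repeated van der Corput differencing removes a phase. -/
lemma IsPhase.norm_expect_pow_le {d : ℕ} {A : X → ZMod p → ℂ} (hA : IsPhase d A)
    (B : X → ZMod p → ℂ) :
    ‖𝔼 x, 𝔼 y, A x y * B x y‖ ^ (2 ^ (d + 1)) ≤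
      𝔼 h : Fin (d + 1) → ZMod p, ‖𝔼 x, 𝔼 y, ∏ ω, PolyConfig.cj ω (B x (y + dot ω h))‖ := by
  induction d generalizing A B with
  | zero =>
    have h0 : ∀ x y, A x y = A x 0 := fun x y => hA.2 x y 0
    simp_rw [h0]
    refine (norm_expect_expect_sq_le (fun x => A x 0) B fun x => hA.1 x 0).trans ?_
    rw [expect_fin_cons]
    refine Finset.expect_le_expect fun l _ => ?_
    have e0 : ∀ (h : Fin 0 → ZMod p) (x : X) (y : ZMod p),
        ∏ ω, PolyConfig.cj ω (B x (y + dot ω (Fin.cons l h : Fin 1 → ZMod p)))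
          = B x y * conj (B x (y + l)) := fun h x y => by
      rw [prod_cube_cons B]
      simp [dot, PolyConfig.cj]
    simp_rw [e0]
    simp
  | succ d ih =>
    have h1 := norm_expect_expect_sq_le (fun _ : X => (1 : ℂ)) (fun x y => A x y * B x y)
      (by simp)
    simp only [one_mul] at h1
    rw [pow_succ 2 (d + 1), mul_comm, pow_mul, expect_fin_cons]
    refine (pow_le_pow_left₀ (by positivity) h1 _).trans
      ((pow_expect_le _ (fun _ => norm_nonneg _) _).trans
        (Finset.expect_le_expect fun l _ => ?_))
    have h2 := ih (hA.2 l) (fun x y => B x y * conj (B x (y + l)))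
    have e1 : ∀ x y, A x y * B x y * conj (A x (y + l) * B x (y + l))
        = A x y * conj (A x (y + l)) * (B x y * conj (B x (y + l))) := fun x y => by
      rw [map_mul]; ring
    simp_rw [e1]
    refine h2.trans_eq (Finset.expect_congr rfl fun h _ => ?_)
    simp_rw [prod_cube_cons B l h]

end Phase

/-! ### Eliminating functions by van der Corput differencing -/

section Taylor

variable {S : Type*} [CommRing S]

lemma coeff_taylor_top {e : ℕ} {q : Polynomial S} (hq : q.natDegree ≤ e) (t : S) :
    (taylor t q).coeff e = q.coeff e := by
  rcases hq.eq_or_lt with rfl | h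
  · exact Polynomial.coeff_taylor_natDegree (r := t) (f := q)
  · rw [Polynomial.coeff_eq_zero_of_natDegree_lt h, Polynomial.coeff_eq_zero_of_natDegree_lt
      (by rwa [Polynomial.natDegree_taylor])]

lemma coeff_taylor_pred {e : ℕ} {q : Polynomial S} (hq : q.natDegree ≤ e + 1) (t : S) :
    (taylor t q).coeff e = q.coeff e + (e + 1) * t * q.coeff (e + 1) := by
  have h : (Polynomial.hasseDeriv e q).natDegree < 2 := by
    have := Polynomial.natDegree_hasseDeriv_le q e
    omega
  rw [Polynomial.taylor_coeff, Polynomial.eval_eq_sum_range' h]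
  simp only [Finset.sum_range_succ, Finset.sum_range_zero, Polynomial.hasseDeriv_coeff]
  rw [add_comm 1 e, Nat.choose_succ_self_right]
  simp
  ring

end Taylor

section Elim

variable {p : ℕ} [Fact p.Prime] {R : Type} [CommRing R] [Algebra (ZMod p) R]

/-- The value of a polynomial over a `ZMod p`-algebra at an element of `ZMod p`. -/
noncomputable def ev (q : Polynomial R) (y : ZMod p) : R := q.eval (algebraMap (ZMod p) R y)

lemma ev_add (q r : Polynomial R) (y : ZMod p) : ev (q + r) y = ev q y + ev r y := by
  simp [ev]

lemma ev_sub (q r : Polynomial R) (y : ZMod p) : ev (q - r) y = ev q y - ev r y := by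
  simp [ev]

lemma ev_taylor (q : Polynomial R) (t y : ZMod p) :
    ev (taylor (algebraMap (ZMod p) R t) q) y = ev q (y + t) := by
  simp [ev, Polynomial.taylor_eval]

/-- Translating `x` by a function of `y` does not change a double average. -/
lemma expect_translate {R : Type} [AddCommGroup R] [Fintype R] (F : R → ZMod p → ℂ)
    (u : ZMod p → R) :
    𝔼 x, 𝔼 y, F (x + u y) y = 𝔼 x, 𝔼 y, F x y := by
  rw [Finset.expect_comm, Finset.expect_comm univ univ F]
  exact expect_congr' fun y => expect_add_right (fun x => F x y) (u y)

variable [Fintype R]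

/-- The average of `∏ j, g j (x + q j (y)) y` against `B` is controlled by averages of products
of translates of `B` alone, with translations prescribed by `r`. -/
def ElimBound (d : ℕ) {ι H : Type} [Fintype ι] [Fintype H] [DecidableEq H]
    (q : ι → Polynomial R) (r : (H → ZMod p) → (H → Bool) → Polynomial R) : Prop :=
  ∀ (g : ι → R → ZMod p → ℂ) (B : R → ZMod p → ℂ), (∀ j, IsPhase d (g j)) →
    (∀ x y, ‖B x y‖ ≤ 1) →
    ‖𝔼 x, 𝔼 y, (∏ j, g j (x + ev (q j) y) y) * B x y‖ ^ (2 ^ Fintype.card H) ≤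
      𝔼 h, ‖𝔼 x, 𝔼 y, ∏ ω, cj ω (B (x + ev (r h ω) y) (y + dot ω h))‖

lemma ElimBound.compose {d : ℕ} {ι H₁ H₂ : Type} [Fintype ι] [Fintype H₁] [DecidableEq H₁]
    [Fintype H₂] [DecidableEq H₂] (P : ι → Prop) [DecidablePred P] {q : ι → Polynomial R}
    {u : Polynomial R} {r₁ s : (H₁ → ZMod p) → (H₁ → Bool) → Polynomial R}
    {r₂ : (H₁ → ZMod p) → (H₂ → ZMod p) → (H₂ → Bool) → Polynomial R}
    (b₁ : ElimBound d (fun j : {j // P j} => q j - u) r₁)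
    (hs : ∀ h ω, s h ω = r₁ h ω - taylor (algebraMap (ZMod p) R (dot ω h)) u)
    (b₂ : ∀ h, ElimBound d (fun j : {j // ¬ P j} × (H₁ → Bool) =>
      s h j.2 + taylor (algebraMap (ZMod p) R (dot j.2 h)) (q j.1)) (r₂ h)) :
    ElimBound d q fun (h : H₁ ⊕ H₂ → ZMod p) ω =>
      r₂ (h ∘ Sum.inl) (h ∘ Sum.inr) (ω ∘ Sum.inr) +
        taylor (algebraMap (ZMod p) R (dot (ω ∘ Sum.inr) (h ∘ Sum.inr)))
          (s (h ∘ Sum.inl) (ω ∘ Sum.inl)) := by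
  intro g B hg hB
  set B₁ : R → ZMod p → ℂ := fun x y =>
    (∏ j : {j // ¬ P j}, g j (x + ev (q j - u) y) y) * B (x - ev u y) y with hB₁
  have hB₁b : ∀ x y, ‖B₁ x y‖ ≤ 1 := fun x y =>
    norm_mul_le_one (prod_norm_le_one _ fun j => (hg _).norm_le _ _) (hB _ _)
  have e1 : 𝔼 x, 𝔼 y, (∏ j, g j (x + ev (q j) y) y) * B x y
      = 𝔼 x, 𝔼 y, (∏ j : {j // P j}, g j (x + ev (q j - u) y) y) * B₁ x y := by
    rw [← expect_translate _ fun y => - ev u y]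
    refine expect_congr' fun x => expect_congr' fun y => ?_
    rw [hB₁, ← mul_assoc, ← Fintype.prod_subtype_mul_prod_subtype P]
    simp only [ev_sub]
    simp only [sub_eq_add_neg, add_assoc, add_comm (-ev u y)]
  have e2 : ∀ h₁ : H₁ → ZMod p,
      𝔼 x, 𝔼 y, ∏ ω, cj ω (B₁ (x + ev (r₁ h₁ ω) y) (y + dot ω h₁))
        = 𝔼 x, 𝔼 y, (∏ j : {j // ¬ P j} × (H₁ → Bool),
            cj j.2 (g j.1 (x + ev (s h₁ j.2 + taylor (algebraMap (ZMod p) R (dot j.2 h₁))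
              (q j.1)) y) (y + dot j.2 h₁))) *
            ∏ ω, cj ω (B (x + ev (s h₁ ω) y) (y + dot ω h₁)) := fun h₁ => by
    refine expect_congr' fun x => expect_congr' fun y => ?_
    rw [Fintype.prod_prod_type, Finset.prod_comm, ← Finset.prod_mul_distrib]
    refine Finset.prod_congr rfl fun ω _ => ?_
    rw [hB₁, map_mul, map_prod]
    simp only [hs, ev_add, ev_sub, ev_taylor]
    congr 1
    · refine Finset.prod_congr rfl fun j _ => ?_
      congr 2; abel
    · congr 2; abel
  rw [e1, Fintype.card_sum, pow_add, pow_mul, expect_sum_arrow]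
  refine (pow_le_pow_left₀ (by positivity) (b₁ (fun j => g j) B₁ (fun j => hg _) hB₁b) _).trans
    ((pow_expect_le _ (fun _ => norm_nonneg _) _).trans (Finset.expect_le_expect fun h₁ _ => ?_))
  rw [e2]
  refine (b₂ h₁ (fun j x y => cj j.2 (g j.1 x (y + dot j.2 h₁)))
    (fun x y => ∏ ω, cj ω (B (x + ev (s h₁ ω) y) (y + dot ω h₁)))
    (fun j => ((hg _).shift _).cj _)
    (fun x y => prod_norm_le_one _ fun ω => (norm_cj _ _).trans_le (hB _ _))).trans_eq ?_
  refine Finset.expect_congr rfl fun h₂ _ => ?_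
  congr 1
  refine expect_congr' fun x => expect_congr' fun y => ?_
  rw [prod_sum_bool]
  refine Finset.prod_congr rfl fun ω₂ _ => ?_
  rw [map_prod]
  refine Finset.prod_congr rfl fun ω₁ _ => ?_
  rw [cj_sum, dot_sumElim]
  simp only [Sum.elim_comp_inl, Sum.elim_comp_inr, ev_add, ev_taylor]
  congr 3
  · abel
  · abel

end Elim

/-- Families of polynomials of degree at most `e` can be eliminated by polynomials of degree at
most `e` with a common coefficient of degree `e`. -/
def Eliminable (d e : ℕ) : Prop :=
  ∀ (ι : Type) [Fintype ι], ∃ (H : Type) (_ : Fintype H) (_ : DecidableEq H),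
    ∀ (p : ℕ) [Fact p.Prime] (R : Type) [CommRing R] [Fintype R] [Algebra (ZMod p) R]
      (q : ι → Polynomial R), (∀ j, (q j).natDegree ≤ e) →
      ∃ r : (H → ZMod p) → (H → Bool) → Polynomial R,
        (∀ h ω, (r h ω).natDegree ≤ e) ∧
        (∀ h ω, (r h ω).coeff e = (r h fun _ => false).coeff e) ∧ ElimBound d q r

/-- As `Eliminable`, for families of degree at most `e + 1` with at most `n` distinct leading
coefficients, and with control of the coefficients of degree `e`. -/
def EliminableClasses (d e n : ℕ) : Prop :=
  ∀ (ι : Type) [Fintype ι] (ℓ : ι → Fin n),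
    ∃ (H : Type) (_ : Fintype H) (_ : DecidableEq H) (κ : H → Fin n),
    ∀ (p : ℕ) [Fact p.Prime] (R : Type) [CommRing R] [Fintype R] [Algebra (ZMod p) R]
      (q : ι → Polynomial R) (α : Fin n → R), (∀ j, (q j).natDegree ≤ e + 1) →
      (∀ j, (q j).coeff (e + 1) = α (ℓ j)) →
      ∃ r : (H → ZMod p) → (H → Bool) → Polynomial R,
        (∀ h ω, (r h ω).natDegree ≤ e + 1) ∧
        (∀ h ω, (r h ω).coeff (e + 1) = (r h fun _ => false).coeff (e + 1)) ∧
        (∀ h ω, (r h ω).coeff e = (r h fun _ => false).coeff e -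
          (e + 1) * ∑ i, (if ω i then algebraMap (ZMod p) R (h i) else 0) * α (κ i)) ∧
        ElimBound d q r

lemma eliminable_zero (d : ℕ) : Eliminable d 0 := by
  intro ι _
  refine ⟨Fin (d + 1), inferInstance, inferInstance, fun p _ R _ _ _ q hq => ⟨0, by simp, by simp,
    fun g B hg _ => ?_⟩⟩
  have hc : ∀ j (y : ZMod p), ev (q j) y = (q j).coeff 0 := fun j y => by
    have h := Polynomial.eq_C_of_natDegree_le_zero (hq j)
    unfold ev
    rw [h]; simp
  have h := (IsPhase.prod univ fun j => (hg j).comp (· + (q j).coeff 0)).norm_expect_pow_le B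
  simp_rw [hc]
  simpa [ev] using h

lemma algebraMap_dot {H : Type} [Fintype H] {p : ℕ} [Fact p.Prime] {R : Type} [CommRing R]
    [Algebra (ZMod p) R] (ω : H → Bool) (h : H → ZMod p) :
    algebraMap (ZMod p) R (dot ω h) = ∑ i, if ω i then algebraMap (ZMod p) R (h i) else 0 := by
  rw [dot, map_sum]
  exact Finset.sum_congr rfl fun i _ => by split_ifs <;> simp

lemma dot_false {H : Type} [Fintype H] {p : ℕ} [Fact p.Prime] (h : H → ZMod p) :
    dot (fun _ => false) h = 0 := by simp [dot]

lemma eliminableClasses_zero (d e : ℕ) : EliminableClasses d e 0 := by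
  intro ι _ ℓ
  refine ⟨Empty, inferInstance, inferInstance, Empty.elim, fun p _ R _ _ _ q α _ _ =>
    ⟨0, by simp, by simp, by simp, fun g B _ _ => ?_⟩⟩
  have : IsEmpty ι := ⟨fun j => (ℓ j).elim0⟩
  simp [ev, dot, cj]

lemma EliminableClasses.step {d e n : ℕ} (h₁ : Eliminable d e) (h₂ : EliminableClasses d e n) :
    EliminableClasses d e (n + 1) := by
  intro ι _ ℓ
  classical
  obtain ⟨H₁, iH₁, jH₁, E₁⟩ := h₁ {j // ℓ j = Fin.last n}
  obtain ⟨H₂, iH₂, jH₂, κ₂, E₂⟩ := h₂ ({j // ¬ ℓ j = Fin.last n} × (H₁ → Bool))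
    fun j => (ℓ j.1).castPred j.1.2
  refine ⟨H₁ ⊕ H₂, inferInstance, inferInstance,
    Sum.elim (fun _ => Fin.last n) fun i => (κ₂ i).castSucc, fun p _ R _ _ _ q α hq hα => ?_⟩
  set a := α (Fin.last n) with ha
  set u : Polynomial R := Polynomial.C a * Polynomial.X ^ (e + 1) with hu
  have hud : u.natDegree ≤ e + 1 := Polynomial.natDegree_C_mul_X_pow_le _ _
  have hu1 : u.coeff (e + 1) = a := by simp [hu]
  have hu0 : u.coeff e = 0 := by simp [hu, Polynomial.coeff_X_pow]
  obtain ⟨r₁, d₁, t₁, b₁⟩ := E₁ p R (fun j => q j - u) fun j => by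
    rw [Polynomial.natDegree_le_iff_coeff_eq_zero]
    intro k hk
    rcases (Nat.succ_le_of_lt hk).eq_or_lt with rfl | hk
    · rw [Polynomial.coeff_sub, hu1, hα, j.2, sub_self]
    · exact Polynomial.coeff_eq_zero_of_natDegree_lt
        ((Polynomial.natDegree_sub_le_of_le (hq _) hud).trans_lt (by simpa using hk))
  obtain ⟨s, hs⟩ : ∃ s : (H₁ → ZMod p) → (H₁ → Bool) → Polynomial R, ∀ h ω, s h ω =
      r₁ h ω - taylor (algebraMap (ZMod p) R (dot ω h)) u := ⟨_, fun _ _ => rfl⟩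
  have hsd : ∀ h ω, (s h ω).natDegree ≤ e + 1 := fun h ω => by
    rw [hs]
    exact (Polynomial.natDegree_sub_le_of_le ((d₁ h ω).trans (Nat.le_succ e))
      ((Polynomial.natDegree_taylor _ _).trans_le hud)).trans_eq (max_self _)
  have hs1 : ∀ h ω, (s h ω).coeff (e + 1) = -a := fun h ω => by
    rw [hs, Polynomial.coeff_sub, coeff_taylor_top hud, hu1,
      Polynomial.coeff_eq_zero_of_natDegree_lt (Nat.lt_succ_of_le (d₁ h ω)), zero_sub]
  have hs0 : ∀ h ω, (s h ω).coeff e = (r₁ h fun _ => false).coeff e -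
      (e + 1) * algebraMap (ZMod p) R (dot ω h) * a := fun h ω => by
    rw [hs, Polynomial.coeff_sub, coeff_taylor_pred hud, hu1, hu0, t₁, zero_add]
  have E := fun h => E₂ p R (fun j => s h j.2 +
      taylor (algebraMap (ZMod p) R (dot j.2 h)) (q j.1))
    (fun l => α l.castSucc - a)
    (fun j => (Polynomial.natDegree_add_le_of_le (hsd _ _)
      ((Polynomial.natDegree_taylor _ _).trans_le (hq _))).trans_eq (max_self _))
    (fun j => by
      rw [Polynomial.coeff_add, hs1, coeff_taylor_top (hq _), hα, Fin.castSucc_castPred]; ring)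
  choose r₂ d₂ t₂ c₂ b₂ using E
  refine ⟨_, fun h ω => ?_, fun h ω => ?_, fun h ω => ?_,
    ElimBound.compose (fun j => ℓ j = Fin.last n) b₁ hs b₂⟩
  · exact (Polynomial.natDegree_add_le_of_le (d₂ _ _ _)
      ((Polynomial.natDegree_taylor _ _).trans_le (hsd _ _))).trans_eq (max_self _)
  · simp only [Polynomial.coeff_add, coeff_taylor_top (hsd _ _), hs1]
    rw [t₂]; rfl
  · simp only [Polynomial.coeff_add, coeff_taylor_pred (hsd _ _), hs1, hs0]
    rw [c₂, algebraMap_dot, algebraMap_dot]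
    simp only [Fintype.sum_sum_type, Sum.elim_inl, Sum.elim_inr, Function.comp_def, dot_false,
      map_zero, mul_sub, Finset.sum_sub_distrib, ← Finset.sum_mul, ← ha]
    ring

lemma eliminableClasses {d e : ℕ} (h : Eliminable d e) (n : ℕ) : EliminableClasses d e n := by
  induction n with
  | zero => exact eliminableClasses_zero d e
  | succ n ih => exact ih.step h

/-- Elimination with explicit coefficients of degree `e`. -/
lemma Eliminable.exists_coeff {d e : ℕ} (he : Eliminable d e) (ι : Type) [Fintype ι] :
    ∃ (H : Type) (_ : Fintype H) (_ : DecidableEq H) (κ : H → ι),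
    ∀ (p : ℕ) [Fact p.Prime] (R : Type) [CommRing R] [Fintype R] [Algebra (ZMod p) R]
      (q : ι → Polynomial R), (∀ j, (q j).natDegree ≤ e + 1) →
      ∃ r : (H → ZMod p) → (H → Bool) → Polynomial R,
        (∀ h ω, (r h ω).natDegree ≤ e + 1) ∧
        (∀ h ω, (r h ω).coeff (e + 1) = (r h fun _ => false).coeff (e + 1)) ∧
        (∀ h ω, (r h ω).coeff e = (r h fun _ => false).coeff e -
          (e + 1) * ∑ i, (if ω i then algebraMap (ZMod p) R (h i) else 0) *
            (q (κ i)).coeff (e + 1)) ∧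
        ElimBound d q r := by
  obtain ⟨H, iH, jH, κ, E⟩ := eliminableClasses he (Fintype.card ι) ι (Fintype.equivFin ι)
  refine ⟨H, iH, jH, fun i => (Fintype.equivFin ι).symm (κ i), fun p _ R _ _ _ q hq => ?_⟩
  exact E p R q (fun l => (q ((Fintype.equivFin ι).symm l)).coeff (e + 1)) hq (by simp)

lemma eliminable (d e : ℕ) : Eliminable d e := by
  induction e with
  | zero => exact eliminable_zero d
  | succ e ih =>
    intro ι _
    obtain ⟨H, iH, jH, κ, E⟩ := ih.exists_coeff ι
    refine ⟨H, iH, jH, fun p _ R _ _ _ q hq => ?_⟩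
    obtain ⟨r, h1, h2, -, h4⟩ := E p R q hq
    exact ⟨r, h1, h2, h4⟩

/-! ### Gowers norms along a vector -/

section Gowers

variable {p : ℕ} [Fact p.Prime] {R : Type} [AddCommGroup R] [Fintype R] [Module (ZMod p) R]

/-- The multiplicative derivative of `f` along `l • v`. -/
noncomputable def mdiff (v : R) (l : ZMod p) (f : R → ℂ) : R → ℂ :=
  fun x => f (x + l • v) * conj (f x)

/-- The `2 ^ (s + 1)`-th power of the Gowers norm of order `s + 1` along `v`. -/
noncomputable def gow (v : R) : ℕ → (R → ℂ) → ℝ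
  | 0, f => 𝔼 x, ‖𝔼 n : ZMod p, f (x + n • v)‖ ^ 2
  | s + 1, f => 𝔼 l : ZMod p, gow v s (mdiff v l f)

lemma gow_nonneg (v : R) (s : ℕ) (f : R → ℂ) : 0 ≤ gow (p := p) v s f := by
  induction s generalizing f with
  | zero => exact Finset.expect_nonneg fun _ _ => by positivity
  | succ s ih => exact Finset.expect_nonneg fun _ _ => ih _

lemma gow_conj (v : R) (s : ℕ) (f : R → ℂ) :
    gow (p := p) v s (fun x => conj (f x)) = gow (p := p) v s f := by
  induction s generalizing f with
  | zero =>
    simp only [gow]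
    refine Finset.expect_congr rfl fun x _ => ?_
    rw [← conj_expect, Complex.norm_conj]
  | succ s ih =>
    simp only [gow]
    refine Finset.expect_congr rfl fun l _ => ?_
    rw [← ih (mdiff v l f)]
    congr 1
    funext x
    simp only [mdiff, map_mul]

lemma expect_line (v : R) (f : R → ℂ) : 𝔼 x, 𝔼 n : ZMod p, f (x + n • v) = 𝔼 x, f x := by
  rw [Finset.expect_comm]
  simp_rw [expect_add_right]
  exact Fintype.expect_const _

lemma norm_expect_sq_le_gow_zero (v : R) (f : R → ℂ) :
    ‖𝔼 x, f x‖ ^ 2 ≤ gow (p := p) v 0 f := by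
  rw [← expect_line (p := p) v f]
  exact norm_expect_pow_le _ 2

lemma expect_cube_le_gow_fin (v : R) (k : ℕ) (g : R → ℂ) :
    𝔼 h : Fin k → ZMod p, ‖𝔼 x, ∏ ω, cj ω (g (x + dot ω h • v))‖ ^ 2 ≤ gow (p := p) v k g := by
  induction k generalizing g with
  | zero => simpa [dot, cj] using norm_expect_sq_le_gow_zero (p := p) v g
  | succ k ih =>
    rw [expect_fin_cons, gow]
    refine Finset.expect_le_expect fun l _ => (le_of_eq ?_).trans (ih (mdiff v l g))
    refine Finset.expect_congr rfl fun h _ => ?_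
    congr 1
    rw [← Complex.norm_conj (𝔼 x, ∏ ω, cj ω (g (x + dot ω _ • v))), conj_expect]
    congr 1
    refine expect_congr' fun x => ?_
    have e := prod_cube_cons (fun (_ : R) y => g (x + y • v)) l h 0 0
    simp only [zero_add] at e
    rw [e, map_prod]
    refine Finset.prod_congr rfl fun ω _ => ?_
    rw [← cj_conj]
    simp only [mdiff, map_mul, Complex.conj_conj, add_smul, add_assoc]
    ring

lemma expect_cube_le_gow {H : Type} [Fintype H] [DecidableEq H] (v : R) (g : R → ℂ) :
    𝔼 h : H → ZMod p, ‖𝔼 x, ∏ ω, cj ω (g (x + dot ω h • v))‖ ^ 2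
      ≤ gow (p := p) v (Fintype.card H) g := by
  refine (le_of_eq ?_).trans (expect_cube_le_gow_fin v _ g)
  let e := Fintype.equivFin H
  refine Fintype.expect_equiv (Equiv.arrowCongr e (Equiv.refl _)) _ _ fun h => ?_
  congr 2
  refine expect_congr' fun x => ?_
  refine Fintype.prod_equiv (Equiv.arrowCongr e (Equiv.refl _)) _ _ fun ω => ?_
  have h1 : dot ((Equiv.arrowCongr e (Equiv.refl _)) ω) ((Equiv.arrowCongr e (Equiv.refl _)) h)
      = dot ω h := by
    simp only [dot]
    exact Fintype.sum_equiv e.symm _ _ fun i => by simp [Equiv.arrowCongr]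
  have h2 : cj ((Equiv.arrowCongr e (Equiv.refl _)) ω) = cj ω := by
    simp only [cj]
    congr 1
    exact Fintype.sum_equiv e.symm _ _ fun i => by simp [Equiv.arrowCongr]
  rw [h1, h2]

end Gowers

/-! ### Control of polynomial averages by Gowers norms -/

section Pet

/-- Averages in which every polynomial difference with `q₀` has degree `e`, with a leading
coefficient that is a nonzero multiple of `v`, are controlled by a Gowers norm along `v`. -/
def PetBound (d e : ℕ) : Prop :=
  ∀ (ι : Type) [Fintype ι], ∃ (s A : ℕ) (C : ℝ), A ≠ 0 ∧ 0 ≤ C ∧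
    ∀ (p : ℕ) [Fact p.Prime] (R : Type) [CommRing R] [Fintype R] [Algebra (ZMod p) R],
      e < p → ∀ (v : R) (q₀ : Polynomial R) (q : ι → Polynomial R) (β : ι → ZMod p),
      (∀ j, (q₀ - q j).natDegree ≤ e) → (∀ j, (q₀ - q j).coeff e = β j • v) →
      (∀ j, β j ≠ 0) → ∀ (g₀ : R → ℂ) (g : ι → R → ZMod p → ℂ), (∀ x, ‖g₀ x‖ ≤ 1) →
      (∀ j, IsPhase d (g j)) →
      ‖𝔼 x, 𝔼 y, g₀ (x + ev q₀ y) * ∏ j, g j (x + ev (q j) y) y‖ ^ A ≤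
        C * ((p : ℝ)⁻¹ + gow (p := p) v s g₀)

lemma pet_reduction (d e : ℕ) (ι : Type) [Fintype ι] :
    ∃ (H : Type) (_ : Fintype H) (_ : DecidableEq H) (κ : H → ι),
    ∀ (p : ℕ) [Fact p.Prime] (R : Type) [CommRing R] [Fintype R] [Algebra (ZMod p) R]
      (v : R) (q₀ : Polynomial R) (q : ι → Polynomial R) (β : ι → ZMod p),
      (∀ j, (q₀ - q j).natDegree ≤ e + 1) → (∀ j, (q₀ - q j).coeff (e + 1) = β j • v) →
      ∃ r : (H → ZMod p) → (H → Bool) → Polynomial R,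
        (∀ h ω, (r h ω).natDegree ≤ e + 1) ∧
        (∀ h ω, (r h ω).coeff (e + 1) = (r h fun _ => false).coeff (e + 1)) ∧
        (∀ h ω, (r h ω).coeff e = (r h fun _ => false).coeff e +
          ((e + 1) * dot ω fun i => h i * β (κ i)) • v) ∧
        ∀ (g₀ : R → ℂ) (g : ι → R → ZMod p → ℂ), (∀ x, ‖g₀ x‖ ≤ 1) → (∀ j, IsPhase d (g j)) →
          ‖𝔼 x, 𝔼 y, g₀ (x + ev q₀ y) * ∏ j, g j (x + ev (q j) y) y‖ ^ (2 ^ Fintype.card H) ≤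
            𝔼 h, ‖𝔼 x, 𝔼 y : ZMod p, ∏ ω, cj ω (g₀ (x + ev (r h ω) y))‖ := by
  obtain ⟨H, iH, jH, κ, E⟩ := (eliminable d e).exists_coeff ι
  refine ⟨H, iH, jH, κ, fun p _ R _ _ _ v q₀ q β hq hβ => ?_⟩
  obtain ⟨r, h1, h2, h3, h4⟩ := E p R (fun j => q j - q₀) fun j => by
    rw [← Polynomial.natDegree_neg, neg_sub]; exact hq j
  refine ⟨r, h1, h2, fun h ω => ?_, fun g₀ g hg₀ hg => ?_⟩
  · have hβ' : ∀ j, (q j - q₀).coeff (e + 1) = -(β j • v) := fun j => by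
      rw [← hβ, ← Polynomial.coeff_neg, neg_sub]
    rw [h3, sub_eq_add_neg, dot, Finset.mul_sum, Finset.mul_sum, Finset.sum_smul,
      ← Finset.sum_neg_distrib]
    congr 1
    refine Finset.sum_congr rfl fun i _ => ?_
    rw [hβ']
    split_ifs
    · simp only [Algebra.smul_def, map_mul, map_add, map_natCast, map_one]; ring
    · simp
  · refine (le_of_eq ?_).trans (h4 g (fun x _ => g₀ x) hg fun x _ => hg₀ x)
    rw [← expect_translate _ fun y => -ev q₀ y]
    congr 2
    refine expect_congr' fun x => expect_congr' fun y => ?_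
    simp only [ev_sub]
    rw [mul_comm, neg_add_cancel_right]
    congr 1
    refine Finset.prod_congr rfl fun j _ => ?_
    congr 1; abel

lemma cj_false {H : Type} [Fintype H] (z : ℂ) : cj (fun _ : H => false) z = z := by simp [cj]

lemma petBound_one (d : ℕ) : PetBound d 1 := by
  intro ι _
  obtain ⟨H, iH, jH, κ, E⟩ := pet_reduction d 0 ι
  refine ⟨Fintype.card H, 2 ^ Fintype.card H * 2, 1, by positivity, zero_le_one,
    fun p _ R _ _ _ _ v q₀ q β hq hβ hβ0 g₀ g hg₀ hg => ?_⟩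
  obtain ⟨r, h1, h2, h3, h4⟩ := E p R v q₀ q β hq hβ
  have e1 : ∀ h, 𝔼 x, 𝔼 y : ZMod p, ∏ ω, cj ω (g₀ (x + ev (r h ω) y))
      = 𝔼 x, ∏ ω, cj ω (g₀ (x + (dot ω fun i => h i * β (κ i)) • v)) := fun h => by
    rw [← expect_translate _ fun y => - ev (r h fun _ => false) y]
    have e2 : ∀ ω (y : ZMod p), ev (r h ω) y = (dot ω fun i => h i * β (κ i)) • v +
        ev (r h fun _ => false) y := fun ω y => by
      have aux : ∀ ω, ev (r h ω) y = (r h ω).coeff 0 + (r h ω).coeff 1 * algebraMap _ R y :=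
        fun ω => by
          unfold ev
          rw [Polynomial.eval_eq_sum_range' (Nat.lt_succ_of_le (h1 h ω))]
          simp [Finset.sum_range_succ]
      rw [aux, aux fun _ => false, h3, h2]
      simp; ring
    refine expect_congr' fun x => ?_
    refine (expect_congr' fun y => ?_).trans (Fintype.expect_const _)
    refine Finset.prod_congr rfl fun ω _ => ?_
    rw [e2 ω]; congr 2; abel
  rw [pow_mul, one_mul]
  calc _ ≤ (𝔼 h, ‖𝔼 x, 𝔼 y : ZMod p, ∏ ω, cj ω (g₀ (x + ev (r h ω) y))‖) ^ 2 :=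
        pow_le_pow_left₀ (by positivity) (h4 g₀ g hg₀ hg) 2
    _ ≤ 𝔼 h, ‖𝔼 x, 𝔼 y : ZMod p, ∏ ω, cj ω (g₀ (x + ev (r h ω) y))‖ ^ 2 :=
        pow_expect_le _ (fun _ => norm_nonneg _) 2
    _ = 𝔼 h : H → ZMod p, ‖𝔼 x, ∏ ω, cj ω (g₀ (x + dot ω h • v))‖ ^ 2 := by
        simp_rw [e1]
        exact Fintype.expect_equiv (Equiv.piCongrRight fun i => Equiv.mulRight₀ _ (hβ0 (κ i)))
          _ _ fun h => rfl
    _ ≤ gow (p := p) v (Fintype.card H) g₀ := expect_cube_le_gow v g₀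
    _ ≤ _ := le_add_of_nonneg_left (by positivity)

lemma expect_eq_zero_indicator {p : ℕ} [Fact p.Prime] {a b : ZMod p} (hb : b ≠ 0) :
    𝔼 t : ZMod p, (if a + t * b = 0 then (1 : ℝ) else 0) = (p : ℝ)⁻¹ := by
  have : 𝔼 t : ZMod p, (if a + t * b = 0 then (1 : ℝ) else 0)
      = 𝔼 t : ZMod p, if t = 0 then (1 : ℝ) else 0 :=
    Fintype.expect_equiv ((Equiv.mulRight₀ b hb).trans (Equiv.addLeft a)) _ _ fun t => rfl
  rw [this, Fintype.expect_eq_sum_div_card]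
  simp [ZMod.card]

lemma expect_dot_eq_zero {p : ℕ} [Fact p.Prime] {H : Type} [Fintype H] [DecidableEq H]
    {b : H → ZMod p} (hb : ∀ i, b i ≠ 0) {ω : H → Bool} (hω : ω ≠ fun _ => false) :
    𝔼 h : H → ZMod p, (if (dot ω fun i => h i * b i) = 0 then (1 : ℝ) else 0) = (p : ℝ)⁻¹ := by
  obtain ⟨i, hi⟩ : ∃ i, ω i = true := by
    by_contra! hn
    exact hω (funext fun i => by simpa using hn i)
  have key : ∀ t : ZMod p,
      𝔼 h : H → ZMod p, (if (dot ω fun j => h j * b j) + t * b i = 0 then (1 : ℝ) else 0)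
      = 𝔼 h : H → ZMod p, (if (dot ω fun j => h j * b j) = 0 then (1 : ℝ) else 0) := fun t => by
    rw [← expect_add_right (fun h : H → ZMod p =>
      if (dot ω fun j => h j * b j) = 0 then (1 : ℝ) else 0) (Pi.single i t)]
    refine Finset.expect_congr rfl fun h _ => ?_
    have : (dot ω fun j => (h + Pi.single i t : H → ZMod p) j * b j)
        = (dot ω fun j => h j * b j) + t * b i := by
      have h1 : t * b i = ∑ j, if j = i then t * b i else 0 := by simp
      rw [dot, dot, h1, ← Finset.sum_add_distrib]
      refine Finset.sum_congr rfl fun j _ => ?_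
      by_cases hj : j = i
      · subst hj; simp [hi, add_mul]
      · simp [hj]
    rw [this]
  calc _ = 𝔼 t : ZMod p, 𝔼 h : H → ZMod p,
        (if (dot ω fun j => h j * b j) + t * b i = 0 then (1 : ℝ) else 0) := by
        simp_rw [key]; rw [Fintype.expect_const]
    _ = _ := by
        rw [Finset.expect_comm]
        simp_rw [expect_eq_zero_indicator (hb i)]
        rw [Fintype.expect_const]

lemma prod_eq_false_mul_prod {H : Type} [Fintype H] [DecidableEq H] (F : (H → Bool) → ℂ) :
    ∏ ω, F ω = F (fun _ => false) * ∏ ω : {ω : H → Bool // ω ≠ fun _ => false}, F ω := by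
  rw [← Finset.mul_prod_erase univ F (Finset.mem_univ fun _ => false)]
  congr 1
  exact Finset.prod_subtype _ (by simp) F

lemma PetBound.succ {d e : ℕ} (he : PetBound d e) : PetBound d (e + 1) := by
  intro ι _
  obtain ⟨H, iH, jH, κ, E⟩ := pet_reduction d e ι
  obtain ⟨s, A, C, hA, hC, M⟩ := he {ω : H → Bool // ω ≠ fun _ => false}
  refine ⟨s, 2 ^ Fintype.card H * A, C + 2 ^ Fintype.card H, by positivity, by positivity,
    fun p _ R _ _ _ hp v q₀ q β hq hβ hβ0 g₀ g hg₀ hg => ?_⟩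
  obtain ⟨r, h1, h2, h3, h4⟩ := E p R v q₀ q β hq hβ
  have hpe : ((e : ZMod p) + 1) ≠ 0 := by
    have := (ZMod.natCast_eq_zero_iff (e + 1) p).not.mpr
      (Nat.not_dvd_of_pos_of_lt (Nat.succ_pos e) hp)
    exact_mod_cast this
  set T : (H → ZMod p) → ℝ := fun h => ‖𝔼 x, 𝔼 y : ZMod p, ∏ ω, cj ω (g₀ (x + ev (r h ω) y))‖
  set G : ℝ := gow (p := p) v s g₀
  have hG : 0 ≤ G := gow_nonneg _ _ _
  have hp0 : (0 : ℝ) ≤ (p : ℝ)⁻¹ := by positivity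
  have hT1 : ∀ h, T h ≤ 1 := fun h => norm_expect_le_one fun x => norm_expect_le_one fun y =>
    prod_norm_le_one _ fun ω => (norm_cj _ _).trans_le (hg₀ _)
  have hT : ∀ h, T h ^ A ≤ C * ((p : ℝ)⁻¹ + G) +
      ∑ ω ∈ univ.filter (fun ω : H → Bool => ω ≠ fun _ => false),
        if (dot ω fun i => h i * β (κ i)) = 0 then (1 : ℝ) else 0 := fun h => by
    by_cases hbad : ∃ ω : H → Bool, ω ≠ (fun _ => false) ∧ (dot ω fun i => h i * β (κ i)) = 0
    · obtain ⟨ω, hω, h0⟩ := hbad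
      have hsum : (1 : ℝ) ≤ ∑ ω ∈ univ.filter (fun ω : H → Bool => ω ≠ fun _ => false),
          if (dot ω fun i => h i * β (κ i)) = 0 then (1 : ℝ) else 0 := by
        refine le_trans ?_ (Finset.single_le_sum (fun _ _ => by split_ifs <;> norm_num)
          (Finset.mem_filter.mpr ⟨Finset.mem_univ ω, hω⟩))
        rw [if_pos h0]
      have := pow_le_one₀ (n := A) (norm_nonneg _) (hT1 h)
      have : 0 ≤ C * ((p : ℝ)⁻¹ + G) := by positivity
      linarith
    · push Not at hbad
      refine le_add_of_le_of_nonneg ?_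
        (Finset.sum_nonneg fun _ _ => by split_ifs <;> norm_num)
      have hM := M p R (by omega) v (r h fun _ => false) (fun ω => r h ω)
        (fun ω => -((e + 1) * dot ω.1 fun i => h i * β (κ i))) (fun ω => by
          rw [Polynomial.natDegree_le_iff_coeff_eq_zero]
          intro k hk
          rcases (Nat.succ_le_of_lt hk).eq_or_lt with rfl | hk
          · rw [Polynomial.coeff_sub, h2 h ω.1, sub_self]
          · exact Polynomial.coeff_eq_zero_of_natDegree_lt
              ((Polynomial.natDegree_sub_le_of_le (h1 _ _) (h1 _ _)).trans_lt (by simpa using hk)))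
        (fun ω => by rw [Polynomial.coeff_sub, h3 h ω.1, neg_smul]; abel)
        (fun ω => neg_ne_zero.mpr (mul_ne_zero hpe (hbad ω.1 ω.2)))
        g₀ (fun ω x _ => cj ω.1 (g₀ x)) hg₀
        (fun ω => IsPhase.of_const d fun x => (norm_cj _ _).trans_le (hg₀ _))
      have key : 𝔼 x, 𝔼 y : ZMod p, ∏ ω, cj ω (g₀ (x + ev (r h ω) y))
          = 𝔼 x, 𝔼 y : ZMod p, g₀ (x + ev (r h fun _ => false) y) *
            ∏ ω : {ω : H → Bool // ω ≠ fun _ => false}, cj ω.1 (g₀ (x + ev (r h ω) y)) :=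
        expect_congr' fun x => expect_congr' fun y => by
          rw [prod_eq_false_mul_prod, cj_false]
      rw [← key] at hM
      exact hM
  rw [pow_mul]
  calc _ ≤ (𝔼 h, T h) ^ A := pow_le_pow_left₀ (by positivity) (h4 g₀ g hg₀ hg) A
    _ ≤ 𝔼 h, T h ^ A := pow_expect_le _ (fun _ => norm_nonneg _) A
    _ ≤ 𝔼 h : H → ZMod p, (C * ((p : ℝ)⁻¹ + G) +
      ∑ ω ∈ univ.filter (fun ω : H → Bool => ω ≠ fun _ => false),
        if (dot ω fun i => h i * β (κ i)) = 0 then (1 : ℝ) else 0) :=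
        Finset.expect_le_expect fun h _ => hT h
    _ = C * ((p : ℝ)⁻¹ + G) +
        ∑ ω ∈ univ.filter (fun ω : H → Bool => ω ≠ fun _ => false), (p : ℝ)⁻¹ := by
        rw [Finset.expect_add_distrib, Fintype.expect_const, Finset.expect_sum_comm]
        congr 1
        refine Finset.sum_congr rfl fun ω hω => ?_
        exact expect_dot_eq_zero (fun i => hβ0 _) (Finset.mem_filter.mp hω).2
    _ ≤ C * ((p : ℝ)⁻¹ + G) + 2 ^ Fintype.card H * (p : ℝ)⁻¹ := by
        rw [Finset.sum_const, nsmul_eq_mul]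
        gcongr
        have := Finset.card_le_univ (univ.filter (fun ω : H → Bool => ω ≠ fun _ => false))
        rw [Fintype.card_fun, Fintype.card_bool] at this
        exact_mod_cast this
    _ ≤ _ := by
        have : 0 ≤ (2 : ℝ) ^ Fintype.card H * G := by positivity
        linarith

lemma petBound (d e : ℕ) : PetBound d (e + 1) := by
  induction e with
  | zero => exact petBound_one d
  | succ e ih => exact ih.succ

end Pet

/-! ### Weyl's inequality and Fourier analysis on `ZMod p` -/

section Fourier

variable {p : ℕ} [Fact p.Prime]

lemma natCast_succ_ne_zero {e : ℕ} (he : e + 1 < p) : ((e : ZMod p) + 1) ≠ 0 := by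
  have := (ZMod.natCast_eq_zero_iff (e + 1) p).not.mpr
    (Nat.not_dvd_of_pos_of_lt (Nat.succ_pos e) he)
  exact_mod_cast this

lemma expect_indicator_zero : 𝔼 t : ZMod p, (if t = 0 then (1 : ℝ) else 0) = (p : ℝ)⁻¹ := by
  simp

/-- Weyl's inequality. -/
lemma norm_expect_ec_eval_pow_le (e : ℕ) (he : e + 1 < p) (Q : Polynomial (ZMod p))
    (hQ : Q.natDegree = e + 1) : ‖𝔼 y, ec (Q.eval y)‖ ^ 2 ^ e ≤ e * (p : ℝ)⁻¹ := by
  induction e generalizing Q with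
  | zero =>
    have h1 : Q.coeff 1 ≠ 0 := by
      have : Q.leadingCoeff ≠ 0 := Polynomial.leadingCoeff_ne_zero.mpr (by rintro rfl; simp at hQ)
      rwa [Polynomial.leadingCoeff, hQ] at this
    have h2 : ∀ y, ec (Q.eval y) = ec (Q.coeff 0) * ec (y * Q.coeff 1) := fun y => by
      rw [← AddChar.map_add_eq_mul, Polynomial.eval_eq_sum_range' (n := 2) (by omega)]
      simp [Finset.sum_range_succ, mul_comm]
    simp_rw [h2]
    rw [← Finset.mul_expect, expect_ec_mul, if_neg h1]
    simp
  | succ e ih =>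
    have h1 := norm_expect_expect_sq_le (fun _ : Unit => (1 : ℂ)) (fun _ y => ec (Q.eval y))
      (by simp)
    simp only [one_mul, Fintype.expect_const] at h1
    rw [pow_succ' 2 e, pow_mul]
    have h2 : ∀ h : ZMod p, ‖𝔼 y, ec (Q.eval y) * conj (ec (Q.eval (y + h)))‖ ^ 2 ^ e ≤
        (if h = 0 then (1 : ℝ) else 0) + e * (p : ℝ)⁻¹ := fun h => by
      split_ifs with hh
      · refine le_add_of_le_of_nonneg (pow_le_one₀ (norm_nonneg _) ?_) (by positivity)
        exact norm_expect_le_one fun y => norm_mul_le_one (norm_ec _).le (by simp)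
      · have h3 : ∀ y, ec (Q.eval y) * conj (ec (Q.eval (y + h)))
            = ec ((Q - taylor h Q).eval y) := fun y => by
          rw [conj_ec, ← AddChar.map_add_eq_mul, Polynomial.eval_sub, Polynomial.taylor_eval,
            sub_eq_add_neg]
        simp_rw [h3]
        rw [zero_add]
        refine ih (by omega) _ (le_antisymm (natDegree_sub_taylor_le hQ.le h) ?_)
        refine Polynomial.le_natDegree_of_ne_zero ?_
        rw [Polynomial.coeff_sub, coeff_taylor_pred hQ.le]
        have h4 : Q.coeff (e + 1 + 1) ≠ 0 := by
          have : Q.leadingCoeff ≠ 0 :=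
            Polynomial.leadingCoeff_ne_zero.mpr (by rintro rfl; simp at hQ)
          rwa [Polynomial.leadingCoeff, hQ] at this
        have h5 := mul_ne_zero (mul_ne_zero (natCast_succ_ne_zero he) hh) h4
        rw [sub_add_cancel_left]
        exact neg_ne_zero.mpr h5
    calc _ ≤ (𝔼 h, ‖𝔼 y, ec (Q.eval y) * conj (ec (Q.eval (y + h)))‖) ^ 2 ^ e :=
          pow_le_pow_left₀ (by positivity) h1 _
      _ ≤ 𝔼 h : ZMod p, ‖𝔼 y, ec (Q.eval y) * conj (ec (Q.eval (y + h)))‖ ^ 2 ^ e :=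
          pow_expect_le _ (fun _ => norm_nonneg _) _
      _ ≤ 𝔼 h : ZMod p, ((if h = 0 then (1 : ℝ) else 0) + e * (p : ℝ)⁻¹) :=
          Finset.expect_le_expect fun h _ => h2 h
      _ = _ := by
          rw [Finset.expect_add_distrib, expect_indicator_zero, Fintype.expect_const]
          push_cast; ring

lemma norm_expect_ec_eval_le {d : ℕ} (hd : d < p) (Q : Polynomial (ZMod p))
    (hQ0 : 0 < Q.natDegree) (hQd : Q.natDegree ≤ d) :
    ‖𝔼 y, ec (Q.eval y)‖ ≤ max (d : ℝ) 1 * (p : ℝ) ^ (-(1 / (2 ^ d : ℕ) : ℝ)) := by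
  refine le_decay_of_pow_le (by positivity) ?_
  obtain ⟨e, he⟩ := Nat.exists_eq_succ_of_ne_zero hQ0.ne'
  rw [Real.rpow_neg_one]
  calc _ ≤ ‖𝔼 y, ec (Q.eval y)‖ ^ 2 ^ e :=
        pow_le_pow_of_le_one (norm_nonneg _) (norm_expect_le_one fun y => (norm_ec _).le)
          (Nat.pow_le_pow_right two_pos (by omega))
    _ ≤ e * (p : ℝ)⁻¹ := norm_expect_ec_eval_pow_le e (by omega) Q he
    _ ≤ _ := by gcongr; omega

lemma expect_mul_indicator (a : ZMod p) (F : ZMod p → ℂ) :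
    𝔼 b, F b * (if a - b = 0 then 1 else 0) = F a / p := by
  rw [Fintype.expect_eq_sum_div_card, ZMod.card]
  congr 1
  simp [sub_eq_zero]

/-- Parseval's identity. -/
lemma expect_norm_fourier_sq (u : ZMod p → ℂ) :
    p * 𝔼 ξ : ZMod p, ‖𝔼 n, u n * ec (-(ξ * n))‖ ^ 2 = 𝔼 n, ‖u n‖ ^ 2 := by
  have hp : (p : ℂ) ≠ 0 := by simp [(Fact.out : p.Prime).ne_zero]
  apply Complex.ofReal_injective
  rw [Complex.ofReal_mul, ofReal_expect, ofReal_expect]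
  have h1 : ∀ ξ : ZMod p, ((‖𝔼 n, u n * ec (-(ξ * n))‖ ^ 2 : ℝ) : ℂ)
      = 𝔼 a, 𝔼 b, u a * conj (u b) * ec (ξ * (b - a)) := fun ξ => by
    rw [norm_expect_sq]
    refine expect_congr' fun a => expect_congr' fun b => ?_
    rw [map_mul, conj_ec, neg_neg, mul_sub, sub_eq_add_neg, AddChar.map_add_eq_mul]
    ring
  simp_rw [h1]
  rw [Finset.expect_comm]
  have h2 : ∀ a : ZMod p, 𝔼 ξ : ZMod p, 𝔼 b, u a * conj (u b) * ec (ξ * (b - a))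
      = ((‖u a‖ ^ 2 : ℝ) : ℂ) / p := fun a => by
    rw [Finset.expect_comm]
    simp_rw [← Finset.mul_expect, expect_ec_mul]
    have h3 : ∀ b, (if b - a = 0 then (1 : ℂ) else 0) = if a - b = 0 then 1 else 0 := fun b => by
      simp only [sub_eq_zero, eq_comm]
    simp_rw [h3]
    rw [expect_mul_indicator, Complex.mul_conj, Complex.normSq_eq_norm_sq]
  rw [Finset.mul_expect]
  refine expect_congr' fun a => ?_
  rw [h2]
  exact mul_div_cancel₀ _ hp

/-- The inverse theorem for the `U²` norm on `ZMod p`. -/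
lemma exists_fourier_ge (u : ZMod p → ℂ) (hu : ∀ n, ‖u n‖ ≤ 1) (ξ₀ : ZMod p)
    (hξ : ∀ ξ, ‖𝔼 n, u n * ec (-(ξ * n))‖ ≤ ‖𝔼 n, u n * ec (-(ξ₀ * n))‖) :
    𝔼 l : ZMod p, ‖𝔼 n, u (n + l) * conj (u n)‖ ^ 2 ≤ ‖𝔼 n, u n * ec (-(ξ₀ * n))‖ ^ 2 := by
  have h1 : ∀ ξ : ZMod p, 𝔼 l, (𝔼 n, u (n + l) * conj (u n)) * ec (-(ξ * l))
      = ((‖𝔼 n, u n * ec (-(ξ * n))‖ ^ 2 : ℝ) : ℂ) := fun ξ => by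
    rw [norm_expect_sq, Finset.expect_comm]
    simp_rw [Finset.expect_mul]
    rw [Finset.expect_comm]
    refine expect_congr' fun n => ?_
    rw [← expect_add_right (fun a => u a * ec (-(ξ * a)) * conj (u n * ec (-(ξ * n)))) n]
    refine expect_congr' fun l => ?_
    have h2 : -(ξ * l) = -(ξ * (l + n)) + ξ * n := by ring
    rw [map_mul, conj_ec, neg_neg, h2, AddChar.map_add_eq_mul, add_comm n l]
    ring
  rw [← expect_norm_fourier_sq]
  simp_rw [h1]
  have hnn : ∀ x : ℝ, ‖((x ^ 2 : ℝ) : ℂ)‖ ^ 2 = x ^ 2 * x ^ 2 := fun x => by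
    rw [Complex.norm_real, Real.norm_of_nonneg (by positivity)]; ring
  simp_rw [hnn]
  calc _ ≤ p * 𝔼 ξ : ZMod p, ‖𝔼 n, u n * ec (-(ξ₀ * n))‖ ^ 2 * ‖𝔼 n, u n * ec (-(ξ * n))‖ ^ 2 := by
        refine mul_le_mul_of_nonneg_left (Finset.expect_le_expect fun ξ _ => ?_) (by positivity)
        have := hξ ξ
        gcongr
    _ = ‖𝔼 n, u n * ec (-(ξ₀ * n))‖ ^ 2 * 𝔼 n, ‖u n‖ ^ 2 := by
        rw [← Finset.mul_expect, ← expect_norm_fourier_sq u]; ring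
    _ ≤ _ := mul_le_of_le_one_right (by positivity)
        (Finset.expect_le univ_nonempty fun n _ => pow_le_one₀ (norm_nonneg _) (hu n))

end Fourier

/-! ### The Gowers–Cauchy–Schwarz inequality for boxes -/

section Box

variable {α : Type}

/-- The vertex of the box spanned by `h` and `h'` indexed by `ω`. -/
def sel {k : ℕ} (ω : Fin k → Bool) (h h' : Fin k → α) : Fin k → α :=
  fun i => if ω i then h' i else h i

lemma sel_cons {k : ℕ} (b : Bool) (ω : Fin k → Bool) (l l' : α) (h h' : Fin k → α) :
    sel (Fin.cons b ω : Fin (k + 1) → Bool) (Fin.cons l h) (Fin.cons l' h')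
      = Fin.cons (if b then l' else l) (sel ω h h') := by
  ext i; refine Fin.cases ?_ (fun i => ?_) i <;> simp [sel]

variable [Fintype α] [Nonempty α]

/-- The Gowers–Cauchy–Schwarz inequality for boxes. -/
lemma box_cauchy_schwarz {k : ℕ} {Z : Type} [Fintype Z] [Nonempty Z]
    (b : Fin k → (Fin k → α) → Z → ℂ) (hb : ∀ i h z, ‖b i h z‖ ≤ 1)
    (hbi : ∀ i h z a, b i (Function.update h i a) z = b i h z) (G : (Fin k → α) → Z → ℂ) :
    ‖𝔼 z, 𝔼 h, (∏ i, b i h z) * G h z‖ ^ 2 ^ k ≤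
      ‖𝔼 h, 𝔼 h', 𝔼 z, ∏ ω, cj ω (G (sel ω h h') z)‖ := by
  induction k generalizing Z with
  | zero => simp [cj, Subsingleton.elim (sel _ _ _) default, Fintype.expect_eq_sum_div_card]
  | succ k ih =>
    obtain ⟨a₀⟩ : Nonempty α := inferInstance
    have h0 : ∀ l (t : Fin k → α) z, b 0 (Fin.cons l t) z = b 0 (Fin.cons a₀ t) z :=
      fun l t z => by rw [← hbi 0 (Fin.cons a₀ t) z l, Fin.update_cons_zero]
    set c : α → (Fin k → α) → Z → ℂ := fun l t z =>
      (∏ i : Fin k, b i.succ (Fin.cons l t) z) * G (Fin.cons l t) z with hc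
    have e1 : 𝔼 z, 𝔼 h, (∏ i, b i h z) * G h z
        = 𝔼 w : Z × (Fin k → α), b 0 (Fin.cons a₀ w.2) w.1 * 𝔼 l, c l w.2 w.1 := by
      rw [expect_prod_type]
      refine expect_congr' fun z => ?_
      rw [expect_fin_cons, Finset.expect_comm]
      refine expect_congr' fun t => ?_
      rw [Finset.mul_expect]
      refine expect_congr' fun l => ?_
      rw [Fin.prod_univ_succ, h0, mul_assoc]
    have e2 : ((𝔼 w : Z × (Fin k → α), ‖𝔼 l, c l w.2 w.1‖ ^ 2 : ℝ) : ℂ)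
        = 𝔼 w : Z × α × α, 𝔼 t : Fin k → α,
          (∏ i : Fin k, b i.succ (Fin.cons w.2.1 t) w.1 *
            conj (b i.succ (Fin.cons w.2.2 t) w.1)) *
          (G (Fin.cons w.2.1 t) w.1 * conj (G (Fin.cons w.2.2 t) w.1)) := by
      rw [ofReal_expect, expect_prod_type, expect_prod_type]
      refine expect_congr' fun z => ?_
      rw [Finset.expect_comm]
      refine expect_congr' fun t => ?_
      rw [norm_expect_sq, expect_prod_type]
      refine expect_congr' fun l => expect_congr' fun l' => ?_
      simp only [hc, map_mul, map_prod, Finset.prod_mul_distrib]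
      ring
    have h1 : ‖𝔼 z, 𝔼 h, (∏ i, b i h z) * G h z‖ ^ 2 ≤
        𝔼 w : Z × (Fin k → α), ‖𝔼 l, c l w.2 w.1‖ ^ 2 := by
      rw [e1]
      exact norm_expect_mul_sq_le _ _ fun w => hb _ _ _
    have h2 : (𝔼 w : Z × (Fin k → α), ‖𝔼 l, c l w.2 w.1‖ ^ 2) = ‖𝔼 w : Z × α × α, 𝔼 t,
          (∏ i : Fin k, b i.succ (Fin.cons w.2.1 t) w.1 *
            conj (b i.succ (Fin.cons w.2.2 t) w.1)) *
          (G (Fin.cons w.2.1 t) w.1 * conj (G (Fin.cons w.2.2 t) w.1))‖ := by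
      rw [← e2, Complex.norm_real, Real.norm_of_nonneg]
      exact Finset.expect_nonneg fun _ _ => by positivity
    rw [h2] at h1
    rw [pow_succ' 2 k, pow_mul]
    have h3 := ih (Z := Z × α × α)
      (fun i t w => b i.succ (Fin.cons w.2.1 t) w.1 * conj (b i.succ (Fin.cons w.2.2 t) w.1))
      (fun i t w => norm_mul_le_one (hb _ _ _) ((RCLike.norm_conj _).trans_le (hb _ _ _)))
      (fun i t w a => by simp only [Fin.cons_update, hbi])
      (fun t w => G (Fin.cons w.2.1 t) w.1 * conj (G (Fin.cons w.2.2 t) w.1))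
    have e3 : ∀ (l l' : α) (h h' : Fin k → α) z, ∏ ω, cj ω (G (sel ω (Fin.cons l h)
        (Fin.cons l' h')) z) = ∏ ω, cj ω (G (Fin.cons l (sel ω h h')) z *
          conj (G (Fin.cons l' (sel ω h h')) z)) := fun l l' h h' z => by
      rw [prod_fin_cons_bool]
      refine Finset.prod_congr rfl fun ω _ => ?_
      rw [cj_cons_false, cj_cons_true, sel_cons, sel_cons, map_mul]
      simp
    have e4 : 𝔼 h, 𝔼 h', 𝔼 z, ∏ ω, cj ω (G (sel ω h h') z)
        = 𝔼 h : Fin k → α, 𝔼 h' : Fin k → α, 𝔼 w : Z × α × α,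
          ∏ ω, cj ω (G (Fin.cons w.2.1 (sel ω h h')) w.1 *
            conj (G (Fin.cons w.2.2 (sel ω h h')) w.1)) := by
      simp_rw [expect_fin_cons (k := k), expect_prod_type, e3]
      symm
      calc _ = 𝔼 h : Fin k → α, 𝔼 h' : Fin k → α, 𝔼 l, 𝔼 l', 𝔼 z,
            ∏ ω, cj ω (G (Fin.cons l (sel ω h h')) z *
              conj (G (Fin.cons l' (sel ω h h')) z)) := by
            refine expect_congr' fun h => expect_congr' fun h' => ?_
            rw [Finset.expect_comm]
            exact expect_congr' fun l => Finset.expect_comm _ _ _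
        _ = 𝔼 h : Fin k → α, 𝔼 l, 𝔼 h' : Fin k → α, 𝔼 l', 𝔼 z,
            ∏ ω, cj ω (G (Fin.cons l (sel ω h h')) z *
              conj (G (Fin.cons l' (sel ω h h')) z)) :=
            expect_congr' fun h => Finset.expect_comm _ _ _
        _ = _ := by
            rw [Finset.expect_comm]
            exact expect_congr' fun l => expect_congr' fun h => Finset.expect_comm _ _ _
    rw [e4]
    exact (pow_le_pow_left₀ (by positivity) h1 _).trans h3

/-- The Gowers–Cauchy–Schwarz inequality for a product of functions each of which is independent
of some coordinate. -/
lemma box_cauchy_schwarz' {k : ℕ} {Z J : Type} [Fintype Z] [Nonempty Z] [Fintype J]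
    (σ : J → Fin k) (b : J → (Fin k → α) → Z → ℂ) (hb : ∀ j h z, ‖b j h z‖ ≤ 1)
    (hbi : ∀ j h z a, b j (Function.update h (σ j) a) z = b j h z) (G : (Fin k → α) → Z → ℂ) :
    ‖𝔼 z, 𝔼 h, (∏ j, b j h z) * G h z‖ ^ 2 ^ k ≤
      ‖𝔼 h, 𝔼 h', 𝔼 z, ∏ ω, cj ω (G (sel ω h h') z)‖ := by
  classical
  have h := box_cauchy_schwarz (fun i h z => ∏ j ∈ univ.filter (fun j => σ j = i), b j h z)
    (fun i h z => prod_norm_le_one _ fun j => hb j h z)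
    (fun i h z a => Finset.prod_congr rfl fun j hj => by
      rw [← (Finset.mem_filter.mp hj).2, hbi]) G
  simp_rw [Finset.prod_fiberwise] at h
  exact h

end Box

/-! ### Iterated multiplicative derivatives -/

section Derivative

variable {p : ℕ} [Fact p.Prime] {R : Type} [AddCommGroup R] [Module (ZMod p) R]

/-- The iterated multiplicative derivative of `f` along the vectors `h i • v`. -/
noncomputable def der {k : ℕ} (v : R) (h : Fin k → ZMod p) (f : R → ℂ) (x : R) : ℂ :=
  ∏ ω : Fin k → Bool, cj (fun i => !ω i) (f (x + dot ω h • v))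

lemma der_zero (v : R) (h : Fin 0 → ZMod p) (f : R → ℂ) : der v h f = f := by
  funext x; simp [der, dot, cj]

lemma not_cons {k : ℕ} (b : Bool) (ω : Fin k → Bool) :
    (fun i => !(Fin.cons b ω : Fin (k + 1) → Bool) i) = Fin.cons (!b) (fun i => !ω i) := by
  ext i; refine Fin.cases ?_ (fun i => ?_) i <;> simp

lemma der_cons {k : ℕ} (v : R) (l : ZMod p) (h : Fin k → ZMod p) (f : R → ℂ) :
    der v (Fin.cons l h : Fin (k + 1) → ZMod p) f = der v h (mdiff v l f) := by
  funext x
  rw [der, prod_fin_cons_bool]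
  refine Finset.prod_congr rfl fun ω _ => ?_
  rw [not_cons, not_cons, dot_cons, dot_cons, Bool.not_false, Bool.not_true, cj_cons_true,
    cj_cons_false, mdiff, map_mul, mul_comm]
  simp only [if_true, Bool.false_eq_true, if_false, zero_add]
  congr 3
  rw [add_smul, add_assoc, add_comm (l • v)]

lemma mdiff_der {k : ℕ} (v : R) (h : Fin k → ZMod p) (l : ZMod p) (f : R → ℂ) :
    mdiff v l (der v h f) = der v h (mdiff v l f) := by
  funext x
  simp only [mdiff, der, map_prod, map_mul, Finset.prod_mul_distrib, ← cj_conj]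
  simp only [add_right_comm]

lemma norm_der_le {k : ℕ} (v : R) (h : Fin k → ZMod p) {f : R → ℂ} (hf : ∀ x, ‖f x‖ ≤ 1) (x : R) :
    ‖der v h f x‖ ≤ 1 :=
  prod_norm_le_one _ fun _ => (norm_cj _ _).trans_le (hf _)

lemma dot_true {H : Type} [Fintype H] (h : H → ZMod p) : dot (fun _ => true) h = ∑ i, h i := by
  simp [dot]

lemma dot_update {H : Type} [Fintype H] [DecidableEq H] {ω : H → Bool} {i : H} (hi : ω i = false)
    (h : H → ZMod p) (a : ZMod p) : dot ω (Function.update h i a) = dot ω h := by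
  refine Finset.sum_congr rfl fun j _ => ?_
  rcases eq_or_ne j i with rfl | hj
  · simp [hi]
  · simp [hj]

/-- The top vertex of the cube defining `der` depends on all the coordinates; all the others miss
a coordinate. -/
lemma der_eq_mul_prod {k : ℕ} (v : R) (h : Fin k → ZMod p) (f : R → ℂ) (x : R) :
    der v h f x = (∏ ω : {ω : Fin k → Bool // ω ≠ fun _ => true},
      cj (fun i => !ω.1 i) (f (x + dot ω.1 h • v))) * f (x + (∑ i, h i) • v) := by
  rw [der, ← Finset.mul_prod_erase univ _ (mem_univ fun _ => true), mul_comm]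
  congr 1
  · rw [← Finset.prod_subtype_of_mem (p := fun ω : Fin k → Bool => ω ≠ fun _ => true)]
    · exact Finset.prod_congr (by ext ω; simp [ω.2]) fun _ _ => rfl
    · exact fun ω hω => Finset.ne_of_mem_erase hω
  · rw [dot_true]
    exact cj_false _

variable [Fintype R]

lemma gow_add (v : R) (j k : ℕ) (f : R → ℂ) :
    gow (p := p) v (j + k) f = 𝔼 h : Fin k → ZMod p, gow (p := p) v j (der v h f) := by
  induction k generalizing f with
  | zero => simp [der_zero]
  | succ k ih =>
    rw [expect_fin_cons, ← add_assoc, gow]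
    refine Finset.expect_congr rfl fun l _ => ?_
    simp_rw [ih, der_cons]

lemma gow_zero_eq (v : R) (f : R → ℂ) :
    ((gow (p := p) v 0 f : ℝ) : ℂ) = 𝔼 l : ZMod p, 𝔼 x, mdiff v l f x := by
  rw [gow, ofReal_expect, Finset.expect_comm]
  have h1 : ∀ x, ((‖𝔼 n : ZMod p, f (x + n • v)‖ ^ 2 : ℝ) : ℂ)
      = 𝔼 n : ZMod p, 𝔼 l, mdiff v l f (x + n • v) := fun x => by
    rw [norm_expect_sq, Finset.expect_comm]
    refine expect_congr' fun n => ?_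
    rw [← expect_add_right (fun m => f (x + m • v) * conj (f (x + n • v))) n]
    refine expect_congr' fun l => ?_
    rw [mdiff, add_smul, add_assoc, add_comm (n • v)]
  simp_rw [h1]
  exact expect_line v fun x => 𝔼 l, mdiff v l f x

lemma gow_eq (v : R) (k : ℕ) (f : R → ℂ) :
    ((gow (p := p) v k f : ℝ) : ℂ)
      = 𝔼 l : ZMod p, 𝔼 h : Fin k → ZMod p, 𝔼 x, der v h (mdiff v l f) x := by
  have := gow_add (p := p) v 0 k f
  rw [zero_add] at this
  rw [this, ofReal_expect, Finset.expect_comm]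
  refine expect_congr' fun h => ?_
  simp_rw [gow_zero_eq, mdiff_der]

end Derivative

/-! ### Frequencies of iterated derivatives -/

section Frequency

variable {p : ℕ} [Fact p.Prime] {R : Type} [AddCommGroup R] [Module (ZMod p) R]

/-- The Fourier coefficient of `g` at the frequency `φ x` along the line through `x` directed
by `v`. -/
noncomputable def lft (v : R) (g : R → ℂ) (φ : R → ZMod p) (x : R) : ℂ :=
  𝔼 n : ZMod p, g (x + n • v) * ec (-(φ x * n))

lemma norm_lft_le {v : R} {g : R → ℂ} (hg : ∀ x, ‖g x‖ ≤ 1) (φ : R → ZMod p) (x : R) :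
    ‖lft v g φ x‖ ≤ 1 :=
  norm_expect_le_one fun _ => norm_mul_le_one (hg _) (norm_ec _).le

lemma fourier_line_add (v : R) (g : R → ℂ) (ξ m : ZMod p) (x : R) :
    𝔼 n : ZMod p, g (x + m • v + n • v) * ec (-(ξ * n))
      = (𝔼 n : ZMod p, g (x + n • v) * ec (-(ξ * n))) * ec (ξ * m) := by
  rw [← expect_add_right (fun n => g (x + n • v) * ec (-(ξ * n))) m, Finset.expect_mul]
  refine expect_congr' fun n => ?_
  have h : -(ξ * n) = -(ξ * (n + m)) + ξ * m := by ring
  rw [h, AddChar.map_add_eq_mul, add_smul, add_assoc, add_comm (m • v), mul_assoc]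

lemma lft_add {v : R} {φ : R → ZMod p} (hφ : ∀ x (m : ZMod p), φ (x + m • v) = φ x) (g : R → ℂ)
    (m : ZMod p) (x : R) : lft v g φ (x + m • v) = lft v g φ x * ec (φ x * m) := by
  rw [lft, hφ, fourier_line_add, lft]

variable [Fintype R]

lemma expect_norm_lft_sq {v : R} {φ : R → ZMod p} (hφ : ∀ x (m : ZMod p), φ (x + m • v) = φ x)
    (g : R → ℂ) :
    ((𝔼 x, ‖lft v g φ x‖ ^ 2 : ℝ) : ℂ) = 𝔼 x, conj (lft v g φ x) * g x := by
  rw [ofReal_expect, ← expect_line (p := p) v (fun x => conj (lft v g φ x) * g x)]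
  refine expect_congr' fun x => ?_
  rw [← Complex.normSq_eq_norm_sq, Complex.normSq_eq_conj_mul_self]
  nth_rw 2 [lft]
  rw [Finset.mul_expect]
  refine expect_congr' fun n => ?_
  rw [lft_add hφ, map_mul, conj_ec]
  ring

/-- A function with large `U²` norm along `v` correlates with linear phases on lines. -/
lemma exists_frequency (v : R) {g : R → ℂ} (hg : ∀ x, ‖g x‖ ≤ 1) :
    ∃ φ : R → ZMod p, (∀ x (m : ZMod p), φ (x + m • v) = φ x) ∧
      gow (p := p) v 1 g ≤ 𝔼 x, ‖lft v g φ x‖ ^ 2 := by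
  choose am ham using fun Ψ : ZMod p → ℝ => Finite.exists_max Ψ
  refine ⟨fun x => am fun ξ => ‖𝔼 n : ZMod p, g (x + n • v) * ec (-(ξ * n))‖, fun x m => ?_, ?_⟩
  · simp_rw [fourier_line_add, norm_mul, norm_ec, mul_one]
  · simp only [gow]
    rw [Finset.expect_comm]
    refine Finset.expect_le_expect fun x _ => ?_
    refine (le_of_eq ?_).trans (exists_fourier_ge (fun n => g (x + n • v)) (fun n => hg _) _
      (ham fun ξ => ‖𝔼 n : ZMod p, g (x + n • v) * ec (-(ξ * n))‖))
    refine Finset.expect_congr rfl fun l _ => ?_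
    simp only [mdiff, add_smul, add_assoc]

end Frequency

/-! ### Alternating sums over boxes -/

section Alternating

variable {α : Type} {k : ℕ}

/-- The sign of a vertex of the cube. -/
def sgn (ω : Fin k → Bool) : ℤ := (-1) ^ ∑ i, (ω i).toNat

/-- The alternating sum of `φ` over the vertices of the box spanned by `h` and `h'`. -/
def alt {M : Type*} [AddCommGroup M] (φ : (Fin k → α) → M) (h h' : Fin k → α) : M :=
  ∑ ω, sgn ω • φ (sel ω h h')

lemma sgn_false : sgn (fun _ : Fin k => false) = 1 := by simp [sgn]

lemma sel_false (h h' : Fin k → α) : sel (fun _ => false) h h' = h :=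
  funext fun _ => if_neg Bool.false_ne_true

lemma sel_update {ω : Fin k → Bool} {i : Fin k} (hi : ω i = true) (h h' : Fin k → α) (a : α) :
    sel ω (Function.update h i a) h' = sel ω h h' := by
  funext j
  rcases eq_or_ne j i with rfl | hj
  · simp [sel, hi]
  · simp [sel, hj]

lemma exists_eq_true {ω : Fin k → Bool} (h : ω ≠ fun _ => false) : ∃ i, ω i = true := by
  by_contra! hc
  exact h (funext fun i => by simpa using hc i)

lemma exists_eq_false {ω : Fin k → Bool} (h : ω ≠ fun _ => true) : ∃ i, ω i = false := by
  by_contra! hc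
  exact h (funext fun i => by simpa using hc i)

lemma alt_eq {M : Type*} [AddCommGroup M] (φ : (Fin k → α) → M) (h h' : Fin k → α) :
    alt φ h h' = φ h + ∑ ω : {ω : Fin k → Bool // ω ≠ fun _ => false},
      sgn ω.1 • φ (sel ω.1 h h') := by
  rw [alt, ← Finset.add_sum_erase univ _ (mem_univ fun _ => false), sgn_false, sel_false, one_smul]
  congr 1
  rw [← Finset.sum_subtype_of_mem (p := fun ω : Fin k → Bool => ω ≠ fun _ => false)]
  · exact Finset.sum_congr (by ext ω; simp [ω.2]) fun _ _ => rfl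
  · exact fun ω hω => Finset.ne_of_mem_erase hω

lemma cj_ec {p : ℕ} [Fact p.Prime] (ω : Fin k → Bool) (a : ZMod p) :
    cj ω (ec a) = ec (sgn ω • a) := by
  unfold cj sgn
  induction ∑ i, (ω i).toNat with
  | zero => simp
  | succ n ih =>
    rw [pow_succ', RingHom.mul_def, RingHom.comp_apply, ih, conj_ec, pow_succ', mul_smul]
    simp

lemma prod_cj_ec {p : ℕ} [Fact p.Prime] (φ : (Fin k → α) → ZMod p) (h h' : Fin k → α) :
    ∏ ω, cj ω (ec (φ (sel ω h h'))) = ec (alt φ h h') := by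
  simp_rw [cj_ec, alt, ec_sum]

lemma sum_sel {p : ℕ} [Fact p.Prime] (ω : Fin k → Bool) (h h' : Fin k → ZMod p) :
    ∑ i, sel ω h h' i = dot (fun i => !ω i) (h - h') + ∑ i, h' i := by
  rw [dot, ← Finset.sum_add_distrib]
  refine Finset.sum_congr rfl fun i _ => ?_
  cases hω : ω i <;> simp [sel, hω]

end Alternating

/-! ### Lowering the degree: from frequencies to Gowers norms -/

section Lower

variable {p : ℕ} [Fact p.Prime] {R : Type} [AddCommGroup R] [Module (ZMod p) R]

lemma norm_ofReal_of_nonneg {x : ℝ} (hx : 0 ≤ x) : ‖(x : ℂ)‖ = x := by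
  rw [Complex.norm_real, Real.norm_of_nonneg hx]

lemma norm_lft_sq (v : R) (g : R → ℂ) (φ : R → ZMod p) (x : R) :
    ((‖lft v g φ x‖ ^ 2 : ℝ) : ℂ)
      = 𝔼 n : ZMod p, 𝔼 l : ZMod p, mdiff v l g (x + n • v) * ec (-(φ x * l)) := by
  rw [lft, norm_expect_sq, Finset.expect_comm]
  refine expect_congr' fun n => ?_
  rw [← expect_add_right (fun m => g (x + m • v) * ec (-(φ x * m)) *
    conj (g (x + n • v) * ec (-(φ x * n)))) n]
  refine expect_congr' fun l => ?_
  have h : -(φ x * l) = -(φ x * (l + n)) + φ x * n := by ring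
  rw [h, AddChar.map_add_eq_mul, map_mul, conj_ec, neg_neg, mdiff, add_smul, add_assoc x,
    add_comm (n • v)]
  ring

variable [Fintype R]

lemma expect_box_mdiff (v : R) (k : ℕ) (f : R → ℂ) :
    𝔼 h : Fin k → ZMod p, 𝔼 h' : Fin k → ZMod p, 𝔼 z : R × ZMod p × ZMod p,
        ∏ ω, cj ω (mdiff v z.2.2 f (z.1 + z.2.1 • v + (∑ i, sel ω h h' i) • v))
      = ((gow (p := p) v k f : ℝ) : ℂ) := by
  have h1 : ∀ h h' : Fin k → ZMod p, 𝔼 z : R × ZMod p × ZMod p,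
        ∏ ω, cj ω (mdiff v z.2.2 f (z.1 + z.2.1 • v + (∑ i, sel ω h h' i) • v))
      = 𝔼 l : ZMod p, 𝔼 x, der v (h - h') (mdiff v l f) x := fun h h' => by
    simp_rw [expect_prod_type]
    calc _ = 𝔼 x, 𝔼 l : ZMod p, ∏ ω, cj ω (mdiff v l f (x + (∑ i, sel ω h h' i) • v)) :=
          expect_line v fun x => 𝔼 l : ZMod p,
            ∏ ω, cj ω (mdiff v l f (x + (∑ i, sel ω h h' i) • v))
      _ = 𝔼 l : ZMod p, 𝔼 x, ∏ ω, cj ω (mdiff v l f (x + (∑ i, sel ω h h' i) • v)) :=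
          Finset.expect_comm _ _ _
      _ = _ := expect_congr' fun l => by
          rw [← expect_add_right (der v (h - h') (mdiff v l f)) ((∑ i, h' i) • v)]
          refine expect_congr' fun x => ?_
          rw [der]
          refine Fintype.prod_equiv ⟨fun ω i => !ω i, fun ω i => !ω i, fun ω => by simp,
            fun ω => by simp⟩ _ _ fun ω => ?_
          simp only [Equiv.coe_fn_mk, Bool.not_not, sum_sel, add_smul]
          rw [add_right_comm, add_assoc]
  simp_rw [h1]
  rw [gow_eq, Finset.expect_comm]
  have h2 : ∀ h' : Fin k → ZMod p, 𝔼 h, 𝔼 l : ZMod p, 𝔼 x, der v (h - h') (mdiff v l f) x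
      = 𝔼 l : ZMod p, 𝔼 h : Fin k → ZMod p, 𝔼 x, der v h (mdiff v l f) x := fun h' => by
    simp_rw [sub_eq_add_neg]
    rw [expect_add_right (fun h => 𝔼 l : ZMod p, 𝔼 x, der v h (mdiff v l f) x) (-h'),
      Finset.expect_comm]
  simp_rw [h2]
  exact Fintype.expect_const _

/-- If the frequencies of the derivatives of `f` satisfy an alternating relation for many boxes,
then `f` has a large Gowers norm of lower order. -/
lemma expect_norm_lft_pow_le (v : R) {k : ℕ} {f : R → ℂ} (hf : ∀ x, ‖f x‖ ≤ 1)
    (φ : (Fin k → ZMod p) → R → ZMod p) (h' : Fin k → ZMod p) :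
    (𝔼 h, 𝔼 x, ‖lft v (der v h f) (φ h) x‖ *
      (if alt (fun h => φ h x) h h' = 0 then 1 else 0)) ^ 2 ^ (k + 1) ≤ gow (p := p) v k f := by
  set A : (Fin k → ZMod p) → R → ZMod p := fun h x =>
    -∑ ω : {ω : Fin k → Bool // ω ≠ fun _ => false}, sgn ω.1 • φ (sel ω.1 h h') x with hA
  have s1 : (𝔼 h, 𝔼 x, ‖lft v (der v h f) (φ h) x‖ *
      (if alt (fun h => φ h x) h h' = 0 then 1 else 0)) ^ 2
      ≤ 𝔼 h, 𝔼 x, ‖lft v (der v h f) (A h) x‖ ^ 2 := by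
    refine (pow_expect_le _ (fun h => Finset.expect_nonneg fun x _ => by positivity) 2).trans
      (Finset.expect_le_expect fun h _ => ?_)
    refine (pow_expect_le _ (fun x => by positivity) 2).trans
      (Finset.expect_le_expect fun x _ => ?_)
    split_ifs with h0
    · rw [alt_eq, add_eq_zero_iff_eq_neg] at h0
      have h1 : lft v (der v h f) (φ h) x = lft v (der v h f) (A h) x := by
        simp only [lft, hA, h0]
      rw [h1, mul_one]
    · rw [mul_zero, zero_pow two_ne_zero]; positivity
  choose σ₁ hσ₁ using fun ω : {ω : Fin k → Bool // ω ≠ fun _ => true} => exists_eq_false ω.2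
  choose σ₂ hσ₂ using fun ω : {ω : Fin k → Bool // ω ≠ fun _ => false} => exists_eq_true ω.2
  set b : {ω : Fin k → Bool // ω ≠ fun _ => true} ⊕ {ω : Fin k → Bool // ω ≠ fun _ => false} →
      (Fin k → ZMod p) → R × ZMod p × ZMod p → ℂ := Sum.elim
    (fun ω h z => cj (fun i => !ω.1 i) (mdiff v z.2.2 f (z.1 + z.2.1 • v + dot ω.1 h • v)))
    (fun ω h z => ec (sgn ω.1 • φ (sel ω.1 h h') z.1 * z.2.2)) with hb
  have hmd : ∀ (l : ZMod p) x, ‖mdiff v l f x‖ ≤ 1 := fun l x =>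
    norm_mul_le_one (hf _) ((RCLike.norm_conj _).trans_le (hf _))
  have s2 : ((𝔼 h, 𝔼 x, ‖lft v (der v h f) (A h) x‖ ^ 2 : ℝ) : ℂ)
      = 𝔼 z : R × ZMod p × ZMod p, 𝔼 h, (∏ j, b j h z) *
        mdiff v z.2.2 f (z.1 + z.2.1 • v + (∑ i, h i) • v) := by
    rw [ofReal_expect, Finset.expect_comm]
    refine expect_congr' fun h => ?_
    rw [ofReal_expect]
    simp_rw [expect_prod_type]
    refine expect_congr' fun x => ?_
    rw [norm_lft_sq]
    refine expect_congr' fun n => expect_congr' fun l => ?_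
    rw [mdiff_der, der_eq_mul_prod, Fintype.prod_sum_type]
    simp only [hb, Sum.elim_inl, Sum.elim_inr, ← ec_sum, ← Finset.sum_mul, hA, neg_mul, neg_neg]
    ring
  have s3 := box_cauchy_schwarz' (Sum.elim σ₁ σ₂) b
    (by
      rintro (ω | ω) h z
      · exact (norm_cj _ _).trans_le (hmd _ _)
      · exact (norm_ec _).le)
    (by
      rintro (ω | ω) h z a
      · simp only [hb, Sum.elim_inl, dot_update (hσ₁ ω)]
      · simp only [hb, Sum.elim_inr, sel_update (hσ₂ ω)])
    (fun h z => mdiff v z.2.2 f (z.1 + z.2.1 • v + (∑ i, h i) • v))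
  rw [← s2, norm_ofReal_of_nonneg (Finset.expect_nonneg fun h _ =>
    Finset.expect_nonneg fun x _ => by positivity), expect_box_mdiff,
    norm_ofReal_of_nonneg (gow_nonneg v k f)] at s3
  rw [pow_succ' 2 k, pow_mul]
  exact (pow_le_pow_left₀ (by positivity) s1 _).trans s3

end Lower

section AlternatingMap

variable {α : Type} {M N : Type*} {k : ℕ} [AddCommGroup M] [AddCommGroup N]

lemma map_alt (g : M →+ N) (φ : (Fin k → α) → M) (h h' : Fin k → α) :
    g (alt φ h h') = alt (fun h => g (φ h)) h h' := by
  simp [alt, map_sum, map_zsmul]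

lemma alt_sub (φ ψ : (Fin k → α) → M) (h h' : Fin k → α) :
    alt (fun h => φ h - ψ h) h h' = alt φ h h' - alt ψ h h' := by
  simp [alt, smul_sub]

lemma alt_smul {S : Type*} [Ring S] [Module S M] (φ : (Fin k → α) → S) (q : M)
    (h h' : Fin k → α) : alt (fun h => φ h • q) h h' = alt φ h h' • q := by
  simp only [alt, Finset.sum_smul, smul_assoc]

lemma alt_mem {S : Type*} [Ring S] [Module S M] (W : Submodule S M)
    {φ : (Fin k → α) → M} (hφ : ∀ h, φ h ∈ W) (h h' : Fin k → α) : alt φ h h' ∈ W :=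
  Submodule.sum_mem _ fun _ _ => zsmul_mem (hφ _) _

end AlternatingMap

/-! ### Polynomial configurations and their dual functions -/

section Config

/-- All the nonzero elements of `W` have positive degree at most `d`, larger than every `deg i`. -/
def Admissible {S : Type*} [Field S] (d : ℕ) {m : ℕ} (deg : Fin m → ℕ)
    (W : Submodule S (Polynomial S)) : Prop :=
  ∀ q ∈ W, q ≠ 0 → 0 < q.natDegree ∧ q.natDegree ≤ d ∧ ∀ i, deg i < q.natDegree

lemma Admissible.natDegree_add {S : Type*} [Field S] {d m : ℕ} {deg : Fin (m + 1) → ℕ}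
    {W : Submodule S (Polynomial S)} (hW : Admissible d deg W) {P : Polynomial S}
    (hP : P.natDegree = deg (Fin.last m)) {w : Polynomial S} (hw : w ∈ W) (hw0 : w ≠ 0) (a : S) :
    (w + a • P).natDegree = w.natDegree :=
  Polynomial.natDegree_add_eq_left_of_natDegree_lt
    ((Polynomial.natDegree_smul_le a P).trans_lt (hP ▸ (hW w hw hw0).2.2 _))

lemma Admissible.sup_span {S : Type*} [Field S] {d m : ℕ} {deg : Fin (m + 1) → ℕ}
    (hdeg : StrictMono deg) (hpos : ∀ i, 0 < deg i) (hd : ∀ i, deg i ≤ d)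
    {W : Submodule S (Polynomial S)} (hW : Admissible d deg W) {P : Polynomial S}
    (hP : P.natDegree = deg (Fin.last m)) :
    Admissible d (fun i : Fin m => deg i.castSucc) (W ⊔ Submodule.span S {P}) := by
  intro q hq hq0
  obtain ⟨w, hw, r, hr, rfl⟩ := Submodule.mem_sup.mp hq
  obtain ⟨a, rfl⟩ := Submodule.mem_span_singleton.mp hr
  by_cases hw0 : w = 0
  · subst hw0
    rw [zero_add] at hq0 ⊢
    have ha : a ≠ 0 := by rintro rfl; simp at hq0
    rw [Polynomial.natDegree_smul _ ha, hP]
    exact ⟨hpos _, hd _, fun i => hdeg (Fin.castSucc_lt_last i)⟩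
  · rw [hW.natDegree_add hP hw hw0]
    obtain ⟨h1, h2, h3⟩ := hW w hw hw0
    exact ⟨h1, h2, fun i => h3 _⟩

lemma Admissible.eq_zero_of_sub_smul {S : Type*} [Field S] {d m : ℕ} {deg : Fin (m + 1) → ℕ}
    (hpos : ∀ i, 0 < deg i) {W : Submodule S (Polynomial S)} (hW : Admissible d deg W)
    {P : Polynomial S} (hP : P.natDegree = deg (Fin.last m)) {w : Polynomial S} (hw : w ∈ W)
    {a : S} (h : w - a • P = 0) : a = 0 := by
  by_contra ha
  have hP0 : P ≠ 0 := by rintro rfl; simp at hP; exact (hpos _).ne hP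
  have hw' : w = a • P := sub_eq_zero.mp h
  have h1 := (hW w hw (hw' ▸ smul_ne_zero ha hP0)).2.2 (Fin.last m)
  rw [hw', Polynomial.natDegree_smul _ ha, hP] at h1
  exact lt_irrefl _ h1

variable {p : ℕ} [Fact p.Prime] {R : Type} [AddCommGroup R] [Module (ZMod p) R] {m : ℕ}

/-- The weighted polynomial configuration based at `x` with parameter `y`. -/
noncomputable def config (f₀ : R → ℂ) (f : Fin m → R → ℂ) (v : Fin m → R)
    (P : Fin m → Polynomial (ZMod p)) (Q : R → Polynomial (ZMod p)) (x : R) (y : ZMod p) : ℂ :=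
  f₀ x * (∏ i, f i (x + (P i).eval y • v i)) * ec ((Q x).eval y)

lemma norm_config_le {f₀ : R → ℂ} {f : Fin m → R → ℂ} (hf₀ : ∀ x, ‖f₀ x‖ ≤ 1)
    (hf : ∀ i x, ‖f i x‖ ≤ 1) (v : Fin m → R) (P : Fin m → Polynomial (ZMod p))
    (Q : R → Polynomial (ZMod p)) (x : R) (y : ZMod p) : ‖config f₀ f v P Q x y‖ ≤ 1 :=
  norm_mul_le_one (norm_mul_le_one (hf₀ x) (prod_norm_le_one _ fun i => hf i _)) (norm_ec _).le

lemma prod_cj_config {k : ℕ} (f₀ : R → ℂ) (f : Fin m → R → ℂ) (vs : Fin m → R)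
    (Ps : Fin m → Polynomial (ZMod p)) (Q : R → Polynomial (ZMod p)) (P : Polynomial (ZMod p))
    (v : R) (E : (Fin k → ZMod p) → R → ℂ) (φ : (Fin k → ZMod p) → R → ZMod p)
    (h h' : Fin k → ZMod p) (r : ZMod p) (x : R) (y : ZMod p) :
    ∏ ω, cj ω (E (sel ω h h') x * ec (-(φ (sel ω h h') x * (P.eval y - r))) *
        config f₀ f vs Ps Q (x + (∑ i, sel ω h h' i) • v) y)
      = config
        (fun x => ∏ ω, cj ω (E (sel ω h h') x * (ec (φ (sel ω h h') x * r) *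
          f₀ (x + (∑ i, sel ω h h' i) • v))))
        (fun i x => ∏ ω, cj ω (f i (x + (∑ i, sel ω h h' i) • v))) vs Ps
        (fun x => alt (fun h => Q (x + (∑ i, h i) • v) - φ h x • P) h h') x y := by
  have e1 : ec ((alt (fun h => Q (x + (∑ i, h i) • v) - φ h x • P) h h').eval y)
      = ∏ ω, cj ω (ec ((Q (x + (∑ i, sel ω h h' i) • v)).eval y -
          φ (sel ω h h') x * P.eval y)) := by
    rw [prod_cj_ec (fun h => (Q (x + (∑ i, h i) • v)).eval y - φ h x * P.eval y)]
    congr 1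
    have := map_alt (Polynomial.evalRingHom y).toAddMonoidHom
      (fun h => Q (x + (∑ i, h i) • v) - φ h x • P) h h'
    simpa using this
  simp only [config]
  rw [e1, Finset.prod_comm, ← Finset.prod_mul_distrib, ← Finset.prod_mul_distrib]
  refine Finset.prod_congr rfl fun ω _ => ?_
  rw [← map_prod, ← map_mul, ← map_mul]
  congr 1
  have e2 : ∀ a b c : ZMod p, ec (-(a * (b - r))) * ec c = ec (a * r) * ec (c - a * b) :=
    fun a b c => by
      rw [← AddChar.map_add_eq_mul, ← AddChar.map_add_eq_mul]
      congr 1; ring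
  have e3 : ∀ i, x + (Ps i).eval y • vs i + (∑ i, sel ω h h' i) • v
      = x + (∑ i, sel ω h h' i) • v + (Ps i).eval y • vs i := fun i => add_right_comm _ _ _
  simp_rw [e3]
  linear_combination (E (sel ω h h') x * f₀ (x + (∑ i, sel ω h h' i) • v) *
    ∏ i, f i (x + (∑ i, sel ω h h' i) • v + (Ps i).eval y • vs i)) *
    e2 (φ (sel ω h h') x) (P.eval y) ((Q (x + (∑ i, sel ω h h' i) • v)).eval y)

/-- The dual function of a polynomial configuration with respect to the progression `P y • v`. -/
noncomputable def dual (Φ : R → ZMod p → ℂ) (P : Polynomial (ZMod p)) (v : R) (x : R) : ℂ :=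
  𝔼 y, Φ (x - P.eval y • v) y

variable [Fintype R]

/-- The main term in the count of polynomial configurations. -/
noncomputable def mainTerm (f₀ : R → ℂ) (f : Fin m → R → ℂ) (v : Fin m → R)
    (Q : R → Polynomial (ZMod p)) : ℂ :=
  𝔼 x, f₀ x * (∏ i, 𝔼 n : ZMod p, f i (x + n • v i)) * (if Q x = 0 then 1 else 0)

/-- The count of polynomial configurations of degrees `deg` in `R` is within `B` of its
main term. -/
def CountAt (p : ℕ) [Fact p.Prime] (R : Type) [AddCommGroup R] [Module (ZMod p) R] [Fintype R]
    (d : ℕ) (deg : Fin m → ℕ) (B : ℝ) : Prop :=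
  ∀ (v : Fin m → R) (P : Fin m → Polynomial (ZMod p)), (∀ i, (P i).natDegree = deg i) →
  ∀ W : Submodule (ZMod p) (Polynomial (ZMod p)), Admissible d deg W →
  ∀ Q : R → Polynomial (ZMod p), (∀ x, Q x ∈ W) →
  ∀ (f₀ : R → ℂ) (f : Fin m → R → ℂ), (∀ x, ‖f₀ x‖ ≤ 1) → (∀ i x, ‖f i x‖ ≤ 1) →
    ‖𝔼 x, 𝔼 y, config f₀ f v P Q x y - mainTerm f₀ f v Q‖ ≤ B

/-- Correlation of a dual function with modulated functions controls the number of boxes on which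
the frequencies satisfy an alternating relation. -/
lemma norm_expect_dual_pow_le {d : ℕ} {deg : Fin (m + 1) → ℕ} {B : ℝ} (hdeg : StrictMono deg)
    (hpos : ∀ i, 0 < deg i) (hd : ∀ i, deg i ≤ d)
    (hS : CountAt p R d (fun i : Fin m => deg i.castSucc) B)
    {Ps : Fin m → Polynomial (ZMod p)} (hPs : ∀ i, (Ps i).natDegree = deg i.castSucc)
    {P : Polynomial (ZMod p)} (hP : P.natDegree = deg (Fin.last m))
    {W : Submodule (ZMod p) (Polynomial (ZMod p))} (hW : Admissible d deg W)
    {Q : R → Polynomial (ZMod p)} (hQ : ∀ x, Q x ∈ W) {f₀ : R → ℂ} {f : Fin m → R → ℂ}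
    (hf₀ : ∀ x, ‖f₀ x‖ ≤ 1) (hf : ∀ i x, ‖f i x‖ ≤ 1) (vs : Fin m → R) (v : R) {k : ℕ}
    {E : (Fin k → ZMod p) → R → ℂ} (hE : ∀ h x, ‖E h x‖ ≤ 1) {φ : (Fin k → ZMod p) → R → ZMod p}
    (hφ : ∀ h x (n : ZMod p), E h (x + n • v) = E h x * ec (-(φ h x * n)))
    {J : Type} [Fintype J] (σ : J → Fin k) {b : J → (Fin k → ZMod p) → R → ℂ}
    (hb : ∀ j h x, ‖b j h x‖ ≤ 1)
    (hbi : ∀ j h x a, b j (Function.update h (σ j) a) x = b j h x) (r : ZMod p) :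
    ‖𝔼 x, 𝔼 h, (∏ j, b j h x) * (E h x *
      dual (config f₀ f vs Ps Q) P v (x + (∑ i, h i) • v + r • v))‖ ^ 2 ^ k ≤
    (𝔼 h, 𝔼 h', 𝔼 x, ‖E h x‖ * (if alt (fun h => φ h x) h h' = 0 then 1 else 0)) + B := by
  set Φ := config f₀ f vs Ps Q with hΦ
  have e1 : 𝔼 x, 𝔼 h, (∏ j, b j h x) * (E h x * dual Φ P v (x + (∑ i, h i) • v + r • v))
      = 𝔼 z : R × ZMod p, 𝔼 h, (∏ j, b j h z.1) *
        (E h z.1 * Φ (z.1 + (∑ i, h i) • v + r • v - P.eval z.2 • v) z.2) := by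
    rw [expect_prod_type]
    refine expect_congr' fun x => ?_
    rw [Finset.expect_comm]
    refine expect_congr' fun h => ?_
    simp_rw [dual, Finset.mul_expect]
  have s1 := box_cauchy_schwarz' σ (fun j h (z : R × ZMod p) => b j h z.1)
    (fun j h z => hb j h z.1) (fun j h z a => hbi j h z.1 a)
    (fun h z => E h z.1 * Φ (z.1 + (∑ i, h i) • v + r • v - P.eval z.2 • v) z.2)
  rw [e1]
  refine s1.trans ?_
  have s2 : ∀ h h' : Fin k → ZMod p, ‖𝔼 z : R × ZMod p, ∏ ω, cj ω (E (sel ω h h') z.1 *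
      Φ (z.1 + (∑ i, sel ω h h' i) • v + r • v - P.eval z.2 • v) z.2)‖ ≤
      (𝔼 x, ‖E h x‖ * (if alt (fun h => φ h x) h h' = 0 then 1 else 0)) + B := fun h h' => by
    set f₀' : R → ℂ := fun x => ∏ ω, cj ω (E (sel ω h h') x * (ec (φ (sel ω h h') x * r) *
          f₀ (x + (∑ i, sel ω h h' i) • v))) with hf₀'
    set f' : Fin m → R → ℂ := fun i x => ∏ ω, cj ω (f i (x + (∑ i, sel ω h h' i) • v)) with hf'
    set Q' : R → Polynomial (ZMod p) := fun x =>
      alt (fun h => Q (x + (∑ i, h i) • v) - φ h x • P) h h' with hQ'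
    have e2 : 𝔼 z : R × ZMod p, ∏ ω, cj ω (E (sel ω h h') z.1 *
        Φ (z.1 + (∑ i, sel ω h h' i) • v + r • v - P.eval z.2 • v) z.2)
        = 𝔼 x, 𝔼 y, config f₀' f' vs Ps Q' x y := by
      rw [expect_prod_type, ← expect_translate (fun x y => ∏ ω, cj ω (E (sel ω h h') x *
        Φ (x + (∑ i, sel ω h h' i) • v + r • v - P.eval y • v) y))
        (fun y => (P.eval y - r) • v)]
      refine expect_congr' fun x => expect_congr' fun y => ?_
      rw [← prod_cj_config]
      refine Finset.prod_congr rfl fun ω _ => ?_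
      have e3 : x + (P.eval y - r) • v + (∑ i, sel ω h h' i) • v + r • v - P.eval y • v
          = x + (∑ i, sel ω h h' i) • v := by rw [sub_smul]; abel
      rw [hφ, e3]
    have hvert : ∀ x ω, ‖cj ω (E (sel ω h h') x * (ec (φ (sel ω h h') x * r) *
          f₀ (x + (∑ i, sel ω h h' i) • v)))‖ ≤ ‖E (sel ω h h') x‖ := fun x ω => by
      rw [norm_cj, norm_mul]
      exact mul_le_of_le_one_right (norm_nonneg _) (norm_mul_le_one (norm_ec _).le (hf₀ _))
    have hf₀'1 : ∀ x, ‖f₀' x‖ ≤ ‖E h x‖ := fun x => by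
      simp only [hf₀']
      rw [prod_eq_false_mul_prod, norm_mul]
      refine (mul_le_of_le_one_right (norm_nonneg _) (prod_norm_le_one _ fun ω => ?_)).trans ?_
      · exact (hvert x _).trans (hE _ _)
      · have := hvert x fun _ => false
        rwa [sel_false] at this
    have hf'1 : ∀ i x, ‖f' i x‖ ≤ 1 := fun i x =>
      prod_norm_le_one _ fun ω => (norm_cj _ _).trans_le (hf _ _)
    have hQW : ∀ x, Q' x ∈ W ⊔ Submodule.span (ZMod p) {P} := fun x => alt_mem _
      (fun h => sub_mem (Submodule.mem_sup_left (hQ _)) (Submodule.mem_sup_right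
        (Submodule.smul_mem _ _ (Submodule.mem_span_singleton_self P)))) h h'
    have s3 := hS vs Ps hPs _ (hW.sup_span hdeg hpos hd hP) Q' hQW f₀' f'
      (fun x => (hf₀'1 x).trans (hE _ _)) hf'1
    have s4 : ‖mainTerm f₀' f' vs Q'‖ ≤
        𝔼 x, ‖E h x‖ * (if alt (fun h => φ h x) h h' = 0 then 1 else 0) := by
      refine (RCLike.norm_expect_le (K := ℂ)).trans (Finset.expect_le_expect fun x _ => ?_)
      rw [norm_mul, norm_mul]
      have h5 : ‖(if Q' x = 0 then (1 : ℂ) else 0)‖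
          ≤ if alt (fun h => φ h x) h h' = 0 then 1 else 0 := by
        by_cases h6 : Q' x = 0
        · have h7 : alt (fun h => φ h x) h h' = 0 := by
            refine hW.eq_zero_of_sub_smul hpos hP
              (alt_mem W (fun h => hQ (x + (∑ i, h i) • v)) h h')
              ?_
            rw [← alt_smul, ← alt_sub]
            exact h6
          simp [h6, h7]
        · rw [if_neg h6, norm_zero]; positivity
      refine mul_le_mul ((mul_le_of_le_one_right (norm_nonneg _) (prod_norm_le_one _ fun i =>
        norm_expect_le_one fun n => hf'1 _ _)).trans (hf₀'1 x)) h5 (norm_nonneg _) (norm_nonneg _)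
    rw [e2]
    calc _ ≤ ‖mainTerm f₀' f' vs Q'‖ +
          ‖𝔼 x, 𝔼 y, config f₀' f' vs Ps Q' x y - mainTerm f₀' f' vs Q'‖ :=
          norm_le_norm_add_norm_sub' _ _
      _ ≤ _ := add_le_add s4 s3
  calc _ ≤ 𝔼 h, 𝔼 h', ‖𝔼 z : R × ZMod p, ∏ ω, cj ω (E (sel ω h h') z.1 *
        Φ (z.1 + (∑ i, sel ω h h' i) • v + r • v - P.eval z.2 • v) z.2)‖ :=
        (RCLike.norm_expect_le (K := ℂ)).trans
          (Finset.expect_le_expect fun h _ => RCLike.norm_expect_le (K := ℂ))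
    _ ≤ 𝔼 h, 𝔼 h', ((𝔼 x, ‖E h x‖ * (if alt (fun h => φ h x) h h' = 0 then 1 else 0)) + B) :=
        Finset.expect_le_expect fun h _ => Finset.expect_le_expect fun h' _ => s2 h h'
    _ = _ := by
        simp_rw [Finset.expect_add_distrib, Fintype.expect_const]

end Config

/-! ### Dual functions have small Gowers norms -/

section DualGowers

/-- The decay rate obtained by iterating a polynomial inequality between consecutive terms. -/
lemma exists_decay_of_step {c C : ℝ} (hc : 0 < c) (hC : 0 ≤ C) (s : ℕ) :
    ∃ c' C' : ℝ, 0 < c' ∧ 0 ≤ C' ∧ ∀ (p : ℕ) [Fact p.Prime] (G : ℕ → ℝ), G 0 = 0 →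
      (∀ k, ∃ S, G (k + 1) ^ 2 ^ k ≤ S + C * (p : ℝ) ^ (-c) ∧ S ^ 2 ^ (k + 1) ≤ G k) →
      G s ≤ C' * (p : ℝ) ^ (-c') := by
  induction s with
  | zero => exact ⟨1, 0, one_pos, le_rfl, fun p _ G h0 _ => by simp [h0]⟩
  | succ s ih =>
    obtain ⟨c', C', hc', hC', h⟩ := ih
    refine ⟨min (c' / (2 ^ (s + 1) : ℕ)) c / (2 ^ s : ℕ), max (max C' 1 + C) 1, ?_, by positivity,
      fun p _ G h0 hG => ?_⟩
    · have : 0 < min (c' / (2 ^ (s + 1) : ℕ)) c := lt_min (by positivity) hc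
      positivity
    · obtain ⟨S, hS1, hS2⟩ := hG s
      exact le_decay_of_pow_le (by positivity) (decay_add_le (by positivity) hC hS1
        (le_decay_of_pow_le (by positivity) (hS2.trans (h p G h0 hG))) le_rfl)

/-- Half of the difference between `F` and its average along `v`. -/
noncomputable def centred (p : ℕ) [Fact p.Prime] {R : Type} [AddCommGroup R] [Module (ZMod p) R]
    (v : R) (F : R → ℂ) (x : R) : ℂ :=
  2⁻¹ * (F x - 𝔼 r : ZMod p, F (x + r • v))

lemma norm_half_sub_le {a b : ℂ} {M : ℝ} (ha : ‖a‖ ≤ M) (hb : ‖b‖ ≤ M) :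
    ‖2⁻¹ * (a - b)‖ ≤ M := by
  rw [norm_mul, norm_inv, Complex.norm_ofNat]
  linarith [norm_sub_le a b]

variable {p : ℕ} [Fact p.Prime] {R : Type} [AddCommGroup R] [Module (ZMod p) R]

lemma norm_centred_le (v : R) {F : R → ℂ} (hF : ∀ x, ‖F x‖ ≤ 1) (x : R) :
    ‖centred p v F x‖ ≤ 1 :=
  norm_half_sub_le (hF x) (norm_expect_le_one fun _ => hF _)

lemma expect_line_centred (v : R) (F : R → ℂ) (x : R) :
    𝔼 n : ZMod p, centred p v F (x + n • v) = 0 := by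
  have h : ∀ n : ZMod p, 𝔼 r : ZMod p, F (x + n • v + r • v) = 𝔼 r : ZMod p, F (x + r • v) :=
    fun n => by
      rw [← expect_add_right (fun r : ZMod p => F (x + r • v)) n]
      refine expect_congr' fun r => ?_
      rw [add_smul, add_assoc, add_comm (n • v)]
  simp only [centred, h]
  rw [← Finset.mul_expect, Finset.expect_sub_distrib, Fintype.expect_const, sub_self, mul_zero]

lemma norm_dual_le {Φ : R → ZMod p → ℂ} (hΦ : ∀ x y, ‖Φ x y‖ ≤ 1) (P : Polynomial (ZMod p))
    (v x : R) : ‖dual Φ P v x‖ ≤ 1 :=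
  norm_expect_le_one fun _ => hΦ _ _

variable [Fintype R] {m : ℕ}

lemma gow_zero_centred (v : R) (F : R → ℂ) : gow (p := p) v 0 (centred p v F) = 0 := by
  simp [gow, expect_line_centred]

lemma exists_gow_dual_step {d : ℕ} {deg : Fin (m + 1) → ℕ} {B : ℝ} (hdeg : StrictMono deg)
    (hpos : ∀ i, 0 < deg i) (hd : ∀ i, deg i ≤ d)
    (hS : CountAt p R d (fun i : Fin m => deg i.castSucc) B)
    {Ps : Fin m → Polynomial (ZMod p)} (hPs : ∀ i, (Ps i).natDegree = deg i.castSucc)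
    {P : Polynomial (ZMod p)} (hP : P.natDegree = deg (Fin.last m))
    {W : Submodule (ZMod p) (Polynomial (ZMod p))} (hW : Admissible d deg W)
    {Q : R → Polynomial (ZMod p)} (hQ : ∀ x, Q x ∈ W) {f₀ : R → ℂ} {f : Fin m → R → ℂ}
    (hf₀ : ∀ x, ‖f₀ x‖ ≤ 1) (hf : ∀ i x, ‖f i x‖ ≤ 1) (vs : Fin m → R) (v : R) (k : ℕ) :
    ∃ S : ℝ,
      gow (p := p) v (k + 1) (centred p v (dual (config f₀ f vs Ps Q) P v)) ^ 2 ^ k ≤ S + B ∧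
      S ^ 2 ^ (k + 1) ≤ gow (p := p) v k (centred p v (dual (config f₀ f vs Ps Q) P v)) := by
  set F := dual (config f₀ f vs Ps Q) P v with hF
  set g := centred p v F with hg
  have hF1 : ∀ x, ‖F x‖ ≤ 1 := norm_dual_le (norm_config_le hf₀ hf vs Ps Q) P v
  have hg1 : ∀ x, ‖g x‖ ≤ 1 := norm_centred_le v hF1
  choose φ hφ hgow using fun h : Fin k → ZMod p =>
    exists_frequency (p := p) v (norm_der_le v h hg1)
  set E : (Fin k → ZMod p) → R → ℂ := fun h x => conj (lft v (der v h g) (φ h) x) with hE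
  have hnE : ∀ h x, ‖E h x‖ = ‖lft v (der v h g) (φ h) x‖ := fun h x => Complex.norm_conj _
  have hE1 : ∀ h x, ‖E h x‖ ≤ 1 := fun h x =>
    (hnE h x).trans_le (norm_lft_le (norm_der_le v h hg1) _ _)
  have hEφ : ∀ h x (n : ZMod p), E h (x + n • v) = E h x * ec (-(φ h x * n)) := fun h x n => by
    simp only [hE, lft_add (hφ h), map_mul, conj_ec]
  choose σ hσ using fun ω : {ω : Fin k → Bool // ω ≠ fun _ => true} => exists_eq_false ω.2
  set b : {ω : Fin k → Bool // ω ≠ fun _ => true} → (Fin k → ZMod p) → R → ℂ := fun ω h x =>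
    cj (fun i => !ω.1 i) (g (x + dot ω.1 h • v)) with hb
  have hb1 : ∀ ω h x, ‖b ω h x‖ ≤ 1 := fun ω h x => (norm_cj _ _).trans_le (hg1 _)
  have hbi : ∀ ω h x a, b ω (Function.update h (σ ω) a) x = b ω h x := fun ω h x a => by
    simp only [hb, dot_update (hσ ω)]
  set T : ZMod p → ℂ := fun r => 𝔼 x, 𝔼 h, (∏ ω, b ω h x) *
    (E h x * F (x + (∑ i, h i) • v + r • v)) with hT
  obtain ⟨r, hr⟩ := Finite.exists_max fun r => ‖T r‖
  have e1 : ((𝔼 h, 𝔼 x, ‖lft v (der v h g) (φ h) x‖ ^ 2 : ℝ) : ℂ) = 2⁻¹ * (T 0 - 𝔼 r, T r) := by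
    have e2 : 𝔼 r, T r = 𝔼 x, 𝔼 h, (∏ ω, b ω h x) *
        (E h x * 𝔼 r : ZMod p, F (x + (∑ i, h i) • v + r • v)) := by
      simp only [hT]
      rw [Finset.expect_comm]
      refine expect_congr' fun x => ?_
      rw [Finset.expect_comm]
      refine expect_congr' fun h => ?_
      rw [← Finset.mul_expect, ← Finset.mul_expect]
    rw [e2]
    simp only [hT]
    rw [← Finset.expect_sub_distrib, Finset.mul_expect, ofReal_expect]
    simp_rw [expect_norm_lft_sq (hφ _)]
    rw [Finset.expect_comm]
    refine expect_congr' fun x => ?_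
    rw [← Finset.expect_sub_distrib, Finset.mul_expect]
    refine expect_congr' fun h => ?_
    rw [der_eq_mul_prod, zero_smul, add_zero]
    simp only [hg, centred, hb, hE]
    ring
  have s1 : gow (p := p) v (k + 1) g ≤ ‖T r‖ := by
    rw [add_comm k 1, gow_add]
    calc _ ≤ 𝔼 h, 𝔼 x, ‖lft v (der v h g) (φ h) x‖ ^ 2 :=
          Finset.expect_le_expect fun h _ => hgow h
      _ = ‖2⁻¹ * (T 0 - 𝔼 r, T r)‖ := by
          rw [← e1, norm_ofReal_of_nonneg]
          exact Finset.expect_nonneg fun h _ => Finset.expect_nonneg fun x _ => by positivity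
      _ ≤ _ := norm_half_sub_le (hr 0) ((RCLike.norm_expect_le (K := ℂ)).trans
          (Finset.expect_le univ_nonempty fun r _ => hr r))
  refine ⟨𝔼 h, 𝔼 h', 𝔼 x, ‖E h x‖ * (if alt (fun h => φ h x) h h' = 0 then 1 else 0),
    (pow_le_pow_left₀ (gow_nonneg _ _ _) s1 _).trans
      (norm_expect_dual_pow_le hdeg hpos hd hS hPs hP hW hQ hf₀ hf vs v hE1 hEφ σ hb1 hbi r), ?_⟩
  rw [Finset.expect_comm]
  refine (pow_expect_le _ (fun h' => Finset.expect_nonneg fun h _ => Finset.expect_nonneg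
    fun x _ => by positivity) _).trans (Finset.expect_le univ_nonempty fun h' _ => ?_)
  simp_rw [hnE]
  exact expect_norm_lft_pow_le v hg1 φ h'

end DualGowers

/-! ### The counting theorem -/

section Counting

/-- The polynomial `P` with values multiplied by `v`. -/
noncomputable def dirPoly {p : ℕ} [Fact p.Prime] {R : Type} [CommRing R] [Algebra (ZMod p) R]
    (P : Polynomial (ZMod p)) (v : R) : Polynomial R :=
  Polynomial.C v * P.map (algebraMap (ZMod p) R)

section DirPoly

variable {p : ℕ} [Fact p.Prime] {R : Type} [CommRing R] [Algebra (ZMod p) R]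

lemma ev_dirPoly (P : Polynomial (ZMod p)) (v : R) (y : ZMod p) :
    ev (dirPoly P v) y = P.eval y • v := by
  rw [ev, dirPoly, Polynomial.eval_mul, Polynomial.eval_C, Polynomial.eval_map_algebraMap,
    Polynomial.aeval_algebraMap_apply, Algebra.smul_def, mul_comm]
  simp

lemma natDegree_dirPoly_le (P : Polynomial (ZMod p)) (v : R) :
    (dirPoly P v).natDegree ≤ P.natDegree :=
  (Polynomial.natDegree_C_mul_le _ _).trans Polynomial.natDegree_map_le

lemma coeff_dirPoly (P : Polynomial (ZMod p)) (v : R) (n : ℕ) :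
    (dirPoly P v).coeff n = P.coeff n • v := by
  rw [dirPoly, Polynomial.coeff_C_mul, Polynomial.coeff_map, Algebra.smul_def, mul_comm]

end DirPoly

lemma PetBound.exists_config_bound {d e : ℕ} (hpet : PetBound d e) (m : ℕ) :
    ∃ (s A : ℕ) (C : ℝ), A ≠ 0 ∧ 0 ≤ C ∧
    ∀ (p : ℕ) [Fact p.Prime] (R : Type) [CommRing R] [Fintype R] [Algebra (ZMod p) R], e < p →
      ∀ (v : R) (P : Polynomial (ZMod p)), P.natDegree = e → P ≠ 0 → ∀ (vs : Fin m → R)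
      (Ps : Fin m → Polynomial (ZMod p)), (∀ i, (Ps i).natDegree < e) → 0 < e →
      ∀ (f₀ : R → ℂ) (f : Fin m → R → ℂ) (Q : R → Polynomial (ZMod p)) (g : R → ℂ),
      (∀ x, ‖f₀ x‖ ≤ 1) → (∀ i x, ‖f i x‖ ≤ 1) → (∀ x, (Q x).natDegree ≤ d) → (∀ x, ‖g x‖ ≤ 1) →
      ‖𝔼 x, 𝔼 y, config f₀ f vs Ps Q x y * g (x + P.eval y • v)‖ ^ A ≤
        C * ((p : ℝ)⁻¹ + gow (p := p) v s g) := by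
  obtain ⟨s, A, C, hA, hC, h⟩ := hpet (Option (Fin m))
  refine ⟨s, A, C, hA, hC, fun p _ R _ _ _ hp v P hP hP0 vs Ps hPs he f₀ f Q g hf₀ hf hQ hg => ?_⟩
  have hlt : ∀ j : Option (Fin m),
      (Option.elim j (0 : Polynomial R) fun i => dirPoly (Ps i) (vs i)).natDegree < e := by
    rintro (_ | i)
    · simpa using he
    · exact (natDegree_dirPoly_le _ _).trans_lt (hPs i)
  have h1 := h p R hp v (dirPoly P v)
    (fun j => Option.elim j 0 fun i => dirPoly (Ps i) (vs i)) (fun _ => P.leadingCoeff)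
    (fun j => (Polynomial.natDegree_sub_le_of_le (hP ▸ natDegree_dirPoly_le P v)
      (hlt j).le).trans_eq (max_self e))
    (fun j => by
      rw [Polynomial.coeff_sub, Polynomial.coeff_eq_zero_of_natDegree_lt (hlt j), sub_zero,
        coeff_dirPoly, Polynomial.leadingCoeff, hP])
    (fun _ => Polynomial.leadingCoeff_ne_zero.mpr hP0) g
    (fun j => Option.elim j (fun x y => f₀ x * ec ((Q x).eval y)) fun i x _ => f i x) hg
    (by
      rintro (_ | i)
      · exact IsPhase.of_polynomial d hf₀ hQ
      · exact IsPhase.of_const d (hf i))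
  have h2 : ∀ x y, config f₀ f vs Ps Q x y * g (x + P.eval y • v)
      = g (x + ev (dirPoly P v) y) * ∏ j : Option (Fin m),
        (Option.elim j (fun x y => f₀ x * ec ((Q x).eval y)) fun i x _ => f i x : R → ZMod p → ℂ)
          (x + ev (Option.elim j 0 fun i => dirPoly (Ps i) (vs i)) y) y := fun x y => by
    rw [Fintype.prod_option]
    simp only [Option.elim, ev_dirPoly, config]
    simp only [ev, Polynomial.eval_zero, add_zero]
    ring
  simp_rw [h2]
  exact h1

section Projection

variable {p : ℕ} [Fact p.Prime] {R : Type} [AddCommGroup R] [Module (ZMod p) R]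

lemma expect_line_add {M : Type*} [AddCommMonoid M] [Module ℚ≥0 M] (v : R) (g : R → M)
    (t : ZMod p) (x : R) :
    𝔼 n : ZMod p, g (x + t • v + n • v) = 𝔼 n : ZMod p, g (x + n • v) := by
  rw [← expect_add_right (fun n : ZMod p => g (x + n • v)) t]
  refine Finset.expect_congr rfl fun n _ => ?_
  rw [add_smul, add_assoc, add_comm (t • v)]

variable [Fintype R] {m : ℕ}

lemma expect_mul_expect_line (v : R) (a b : R → ℂ) :
    𝔼 x, a x * 𝔼 n : ZMod p, b (x + n • v) = 𝔼 x, (𝔼 n : ZMod p, a (x + n • v)) * b x := by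
  simp_rw [Finset.mul_expect, Finset.expect_mul]
  rw [← expect_translate (fun x n => a x * b (x + n • v)) (fun n => (-n) • v)]
  refine expect_congr' fun x => Fintype.expect_equiv (Equiv.neg (ZMod p)) _ _ fun n => ?_
  rw [Equiv.neg_apply, neg_smul, neg_add_cancel_right]

lemma expect_config_mul (Φ : R → ZMod p → ℂ) (P : Polynomial (ZMod p)) (v : R) (g : R → ℂ) :
    𝔼 x, 𝔼 y, Φ x y * g (x + P.eval y • v) = 𝔼 x, dual Φ P v x * g x := by
  rw [← expect_translate _ fun y => (-P.eval y) • v]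
  refine expect_congr' fun x => ?_
  rw [dual, Finset.expect_mul]
  refine expect_congr' fun y => ?_
  rw [neg_smul, neg_add_cancel_right, sub_eq_add_neg]

/-- Replacing `g` by its average along `v` changes the average against `F` by an amount
controlled by the correlation of `F` with its own centred version. -/
lemma norm_expect_sub_expect_line_sq_le (v : R) (F g : R → ℂ) (hg : ∀ x, ‖g x‖ ≤ 1) :
    ‖𝔼 x, F x * g x - 𝔼 x, F x * 𝔼 n : ZMod p, g (x + n • v)‖ ^ 2 ≤
      2 * ‖𝔼 x, F x * conj (centred p v F x)‖ := by
  set G := centred p v F with hG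
  have e1 : 𝔼 x, F x * g x - 𝔼 x, F x * 𝔼 n : ZMod p, g (x + n • v) = 2 * 𝔼 x, g x * G x := by
    rw [expect_mul_expect_line, ← Finset.expect_sub_distrib, Finset.mul_expect]
    refine expect_congr' fun x => ?_
    simp only [hG, centred]
    ring
  have e2 : 𝔼 x, F x * conj (G x) = 2 * ((𝔼 x, ‖G x‖ ^ 2 : ℝ) : ℂ) := by
    have e3 : 𝔼 x, (𝔼 n : ZMod p, F (x + n • v)) * conj (G x) = 0 := by
      rw [← expect_mul_expect_line]
      simp_rw [← conj_expect, hG, expect_line_centred]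
      simp
    rw [← sub_zero (𝔼 x, F x * conj (G x)), ← e3, ← Finset.expect_sub_distrib, ofReal_expect,
      Finset.mul_expect]
    refine expect_congr' fun x => ?_
    have e4 : F x - 𝔼 n : ZMod p, F (x + n • v) = 2 * G x := by
      simp only [hG, centred]
      ring
    rw [← sub_mul, e4, ← Complex.normSq_eq_norm_sq, ← Complex.mul_conj, mul_assoc]
  have h1 := norm_expect_mul_sq_le g G hg
  rw [e1, e2, norm_mul, norm_mul, norm_ofReal_of_nonneg (Finset.expect_nonneg fun x _ =>
    by positivity), Complex.norm_ofNat, mul_pow]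
  linarith

end Projection

/-- The count of polynomial configurations with degrees `deg` is equal to its main term up to a
power of `p`. -/
def CountBound (d : ℕ) {m : ℕ} (deg : Fin m → ℕ) : Prop :=
  ∃ c C : ℝ, 0 < c ∧ 0 ≤ C ∧ ∀ (p : ℕ) [Fact p.Prime], d < p →
    ∀ (R : Type) [CommRing R] [Fintype R] [Algebra (ZMod p) R],
      CountAt p R d deg (C * (p : ℝ) ^ (-c))

lemma countBound_zero (d : ℕ) (deg : Fin 0 → ℕ) : CountBound d deg := by
  refine ⟨1 / (2 ^ d : ℕ), max (d : ℝ) 1, by positivity, by positivity,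
    fun p _ hp R _ _ _ v P hP W hW Q hQ f₀ f hf₀ hf => ?_⟩
  have h1 : ∀ x, ‖(𝔼 y, ec ((Q x).eval y)) - (if Q x = 0 then 1 else 0)‖ ≤
      max (d : ℝ) 1 * (p : ℝ) ^ (-(1 / (2 ^ d : ℕ) : ℝ)) := fun x => by
    split_ifs with h
    · have := (decay_pos (p := p) (1 / (2 ^ d : ℕ))).le
      simp only [h, Polynomial.eval_zero, AddChar.map_zero_eq_one, Fintype.expect_const, sub_self,
        norm_zero]
      positivity
    · rw [sub_zero]
      obtain ⟨h2, h3, -⟩ := hW _ (hQ x) h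
      exact norm_expect_ec_eval_le hp _ h2 h3
  simp only [config, mainTerm, Finset.univ_eq_empty, Finset.prod_empty, mul_one]
  rw [← Finset.expect_sub_distrib]
  refine (RCLike.norm_expect_le (K := ℂ)).trans (Finset.expect_le univ_nonempty fun x _ => ?_)
  rw [← Finset.mul_expect, ← mul_sub, norm_mul]
  exact (mul_le_of_le_one_left (norm_nonneg _) (hf₀ x)).trans (h1 x)

lemma CountBound.succ {d m : ℕ} {deg : Fin (m + 1) → ℕ} (hdeg : StrictMono deg)
    (hpos : ∀ i, 0 < deg i) (hd : ∀ i, deg i ≤ d)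
    (ih : CountBound d fun i : Fin m => deg i.castSucc) : CountBound d deg := by
  obtain ⟨c, C, hc, hC, ih⟩ := ih
  obtain ⟨e, he⟩ := Nat.exists_eq_succ_of_ne_zero (hpos (Fin.last m)).ne'
  obtain ⟨s, A, C₁, hA, hC₁, hpet⟩ := (petBound d e).exists_config_bound m
  obtain ⟨c₂, C₂, hc₂, hC₂, hgow⟩ := exists_decay_of_step hc hC s
  set K := max (2 * max (C₁ * (1 + C₂)) 1) 1 with hK
  refine ⟨min (min 1 c₂ / A / 2) c, K + C, ?_, by positivity,
    fun p _ hp R _ _ _ v P hP W hW Q hQ f₀ f hf₀ hf => ?_⟩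
  · have : 0 < min 1 c₂ := lt_min one_pos hc₂
    have hA' : 0 < (A : ℝ) := by positivity
    exact lt_min (by positivity) hc
  set v₁ := v (Fin.last m) with hv₁
  set P₁ := P (Fin.last m) with hP₁
  set f₁ := f (Fin.last m) with hf₁
  set vs : Fin m → R := fun i => v i.castSucc with hvs
  set Ps : Fin m → Polynomial (ZMod p) := fun i => P i.castSucc with hPs
  set fs : Fin m → R → ℂ := fun i => f i.castSucc with hfs
  set Φ := config f₀ fs vs Ps Q with hΦ
  set F := dual Φ P₁ v₁ with hF
  have hF1 : ∀ x, ‖F x‖ ≤ 1 :=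
    norm_dual_le (norm_config_le hf₀ (fun i => hf i.castSucc) vs Ps Q) P₁ v₁
  have hP₁0 : P₁ ≠ 0 := by
    intro h
    have := hP (Fin.last m)
    rw [← hP₁, h, Polynomial.natDegree_zero] at this
    exact (hpos _).ne this
  have hQd : ∀ x, (Q x).natDegree ≤ d := fun x => by
    by_cases h : Q x = 0
    · simp [h]
    · exact (hW _ (hQ x) h).2.1
  have s1 : gow (p := p) v₁ s (centred p v₁ F) ≤ C₂ * (p : ℝ) ^ (-c₂) :=
    hgow p (fun k => gow (p := p) v₁ k (centred p v₁ F)) (gow_zero_centred v₁ F) fun k =>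
      exists_gow_dual_step hdeg hpos hd (ih p hp R) (fun i => hP i.castSucc) (hP _) hW hQ hf₀
        (fun i => hf i.castSucc) vs v₁ k
  have s2 : ‖𝔼 x, F x * conj (centred p v₁ F x)‖ ≤
      max (C₁ * (1 + C₂)) 1 * (p : ℝ) ^ (-(min 1 c₂ / A)) := by
    refine le_decay_of_pow_le hA ?_
    have h1 := hpet p R (by have := hd (Fin.last m); omega) v₁ P₁ ((hP _).trans he) hP₁0 vs Ps
      (fun i => by
        rw [hP, ← Nat.succ_eq_add_one, ← he]
        exact hdeg (Fin.castSucc_lt_last i)) e.succ_pos f₀ fs Q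
      (fun x => conj (centred p v₁ F x)) hf₀ (fun i => hf i.castSucc) hQd
      (fun x => (Complex.norm_conj _).trans_le (norm_centred_le v₁ hF1 x))
    rw [expect_config_mul (config f₀ fs vs Ps Q) P₁ v₁ fun x => conj (centred p v₁ F x),
      gow_conj] at h1
    refine h1.trans ?_
    rw [mul_assoc]
    refine mul_le_mul_of_nonneg_left ?_ hC₁
    refine decay_add_le zero_le_one hC₂ le_rfl ?_ s1
    rw [one_mul, Real.rpow_neg_one]
  have e1 : 𝔼 x, 𝔼 y, config f₀ f v P Q x y = 𝔼 x, F x * f₁ x := by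
    rw [hF, ← expect_config_mul Φ P₁ v₁ f₁]
    refine expect_congr' fun x => expect_congr' fun y => ?_
    simp only [hΦ, config, Fin.prod_univ_castSucc]
    ring
  have e2 : 𝔼 x, F x * 𝔼 n : ZMod p, f₁ (x + n • v₁)
      = 𝔼 x, 𝔼 y, config (fun x => f₀ x * 𝔼 n : ZMod p, f₁ (x + n • v₁)) fs vs Ps Q x y := by
    rw [hF, ← expect_config_mul Φ P₁ v₁ fun x => 𝔼 n : ZMod p, f₁ (x + n • v₁)]
    refine expect_congr' fun x => expect_congr' fun y => ?_
    simp only [hΦ, config, expect_line_add]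
    ring
  have e3 : mainTerm f₀ f v Q
      = mainTerm (fun x => f₀ x * 𝔼 n : ZMod p, f₁ (x + n • v₁)) fs vs Q := by
    refine expect_congr' fun x => ?_
    rw [Fin.prod_univ_castSucc]
    ring
  have s3 : ‖𝔼 x, F x * f₁ x - 𝔼 x, F x * 𝔼 n : ZMod p, f₁ (x + n • v₁)‖ ≤
      K * (p : ℝ) ^ (-(min 1 c₂ / A / 2)) := by
    refine le_decay_of_pow_le two_ne_zero
      ((norm_expect_sub_expect_line_sq_le v₁ F f₁ (hf _)).trans ?_)
    rw [mul_assoc]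
    exact mul_le_mul_of_nonneg_left s2 zero_le_two
  have s4 : ‖𝔼 x, F x * (𝔼 n : ZMod p, f₁ (x + n • v₁)) - mainTerm f₀ f v Q‖ ≤
      C * (p : ℝ) ^ (-c) := by
    rw [e2, e3]
    exact ih p hp R vs Ps (fun i => hP _) W
      (fun q hq hq0 => ⟨(hW q hq hq0).1, (hW q hq hq0).2.1, fun i => (hW q hq hq0).2.2 _⟩) Q hQ _ fs
      (fun x => norm_mul_le_one (hf₀ x) (norm_expect_le_one fun n => hf _ _)) fun i => hf i.castSucc
  rw [e1]
  exact decay_add_le (by positivity) hC (norm_sub_le_norm_sub_add_norm_sub _ _ _) s3 s4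

/-- The counting theorem for polynomial configurations with distinct degrees. -/
theorem countBound (d : ℕ) {m : ℕ} (deg : Fin m → ℕ) (hdeg : StrictMono deg)
    (hpos : ∀ i, 0 < deg i) (hd : ∀ i, deg i ≤ d) : CountBound d deg := by
  induction m with
  | zero => exact countBound_zero d deg
  | succ m ih =>
    exact CountBound.succ hdeg hpos hd (ih _ (hdeg.comp (Fin.strictMono_castSucc))
      (fun i => hpos _) fun i => hd _)

end Counting

/-! ### The correlation inequality -/

section Correlation

lemma card_add_one_le_prod_add_sum_inv {ι : Type*} [Fintype ι] (b : ι → ℝ) (hb : ∀ i, 0 < b i) :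
    (Fintype.card ι : ℝ) + 1 ≤ ∏ i, b i + ∑ i, (b i)⁻¹ := by
  have h1 : ∑ i, (1 - Real.log (b i)) ≤ ∑ i, (b i)⁻¹ := Finset.sum_le_sum fun i _ => by
    have := Real.log_le_sub_one_of_pos (inv_pos.mpr (hb i))
    rw [Real.log_inv] at this
    linarith
  have h2 := Real.log_le_sub_one_of_pos (Finset.prod_pos fun i (_ : i ∈ univ) => hb i)
  rw [Real.log_prod fun i _ => (hb i).ne'] at h2
  rw [Finset.sum_sub_distrib, Finset.sum_const, card_univ, nsmul_eq_mul, mul_one] at h1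
  linarith

variable {p : ℕ} [Fact p.Prime] {R : Type} [AddCommGroup R] [Module (ZMod p) R] [Fintype R]

lemma expect_mul_inv_line_le_one (v : R) (f : R → ℝ) :
    𝔼 x, f x * (𝔼 n : ZMod p, f (x + n • v))⁻¹ ≤ 1 := by
  have h1 : 𝔼 x, f x * (𝔼 n : ZMod p, f (x + n • v))⁻¹
      = 𝔼 x, (𝔼 m : ZMod p, f (x + m • v)) * (𝔼 n : ZMod p, f (x + n • v))⁻¹ := by
    simp_rw [Finset.expect_mul]
    rw [Finset.expect_comm]
    have h2 : ∀ m : ZMod p, 𝔼 x, f (x + m • v) * (𝔼 n : ZMod p, f (x + n • v))⁻¹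
        = 𝔼 x, f x * (𝔼 n : ZMod p, f (x + n • v))⁻¹ := fun m => by
      rw [← expect_add_right (fun x => f x * (𝔼 n : ZMod p, f (x + n • v))⁻¹) (m • v)]
      simp_rw [expect_line_add]
    simp_rw [h2]
    rw [Fintype.expect_const]
  rw [h1]
  exact Finset.expect_le univ_nonempty fun x _ => mul_inv_le_one

/-- The correlation inequality for averages along lines. -/
lemma pow_expect_le_expect_mul_prod_line {t : ℕ} (v : Fin t → R) (f : R → ℝ)
    (hf : ∀ x, 0 ≤ f x) :
    (𝔼 x, f x) ^ (t + 1) ≤ 𝔼 x, f x * ∏ i, 𝔼 n : ZMod p, f (x + n • v i) := by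
  set a := 𝔼 x, f x
  have ha : 0 ≤ a := Finset.expect_nonneg fun x _ => hf x
  have hX : 0 ≤ 𝔼 x, f x * ∏ i, 𝔼 n : ZMod p, f (x + n • v i) :=
    Finset.expect_nonneg fun x _ => mul_nonneg (hf x)
      (Finset.prod_nonneg fun i _ => Finset.expect_nonneg fun n _ => hf _)
  obtain ha0 | ha0 := ha.eq_or_lt
  · rwa [← ha0, zero_pow t.succ_ne_zero]
  have h1 : ∀ x, f x * (t + 1) ≤ (a ^ t)⁻¹ * (f x * ∏ i, 𝔼 n : ZMod p, f (x + n • v i))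
      + ∑ i, a * (f x * (𝔼 n : ZMod p, f (x + n • v i))⁻¹) := fun x => by
    obtain h0 | h0 := (hf x).eq_or_lt
    · simp [← h0]
    have hb : ∀ i, 0 < 𝔼 n : ZMod p, f (x + n • v i) := fun i =>
      Finset.expect_pos' (fun n _ => hf _) ⟨0, mem_univ _, by simpa using h0⟩
    have h2 := card_add_one_le_prod_add_sum_inv
      (fun i => (𝔼 n : ZMod p, f (x + n • v i)) / a) fun i => div_pos (hb i) ha0
    rw [Fintype.card_fin, Finset.prod_div_distrib, Finset.prod_const, card_univ,
      Fintype.card_fin] at h2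
    refine (mul_le_mul_of_nonneg_left h2 h0.le).trans_eq ?_
    rw [mul_add, Finset.mul_sum]
    congr 1
    · ring
    · refine Finset.sum_congr rfl fun i _ => ?_
      rw [inv_div]
      ring
  have h3 := Finset.expect_le_expect fun x (_ : x ∈ univ) => h1 x
  rw [← Finset.expect_mul, Finset.expect_add_distrib, ← Finset.mul_expect,
    Finset.expect_sum_comm] at h3
  simp_rw [← Finset.mul_expect] at h3
  have h4 : ∑ i : Fin t, a * 𝔼 x, f x * (𝔼 n : ZMod p, f (x + n • v i))⁻¹ ≤ t * a :=
    (Finset.sum_le_card_nsmul univ _ a fun i _ =>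
      mul_le_of_le_one_right ha0.le (expect_mul_inv_line_le_one (v i) f)).trans_eq (by simp)
  have h5 : a ≤ (a ^ t)⁻¹ * 𝔼 x, f x * ∏ i, 𝔼 n : ZMod p, f (x + n • v i) := by linarith
  rwa [le_inv_mul_iff₀ (by positivity), ← pow_succ] at h5

end Correlation

section Reduction

lemma natDegree_map_intCast {P : Polynomial ℤ} {p : ℕ} (hP : P ≠ 0)
    (hp : P.leadingCoeff.natAbs < p) :
    (P.map (Int.castRingHom (ZMod p))).natDegree = P.natDegree := by
  refine Polynomial.natDegree_map_of_leadingCoeff_ne_zero _ fun h => ?_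
  rw [eq_intCast, ZMod.intCast_zmod_eq_zero_iff_dvd] at h
  have h0 := Polynomial.leadingCoeff_ne_zero.mpr hP
  exact hp.not_ge (Nat.le_of_dvd (Int.natAbs_pos.mpr h0) (Int.natCast_dvd.mp h))

lemma avgR_eq_expect {α : Type*} [Fintype α] (f : α → ℝ) : avgR f = 𝔼 x, f x :=
  (Fintype.expect_eq_sum_div_card f).symm

/-- The counting theorem for a single nonnegative function, combined with the correlation
inequality. -/
lemma CountAt.pow_expect_sub_le {p : ℕ} [Fact p.Prime] {R : Type} [AddCommGroup R]
    [Module (ZMod p) R] [Fintype R] {d t : ℕ} {deg : Fin t → ℕ} {B : ℝ} (h : CountAt p R d deg B)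
    (v : Fin t → R) (P : Fin t → Polynomial (ZMod p)) (hP : ∀ i, (P i).natDegree = deg i)
    (f : R → ℝ) (hf0 : ∀ x, 0 ≤ f x) (hf1 : ∀ x, f x ≤ 1) :
    (𝔼 x, f x) ^ (t + 1) - B ≤ 𝔼 x, 𝔼 y, f x * ∏ i, f (x + (P i).eval y • v i) := by
  have hf : ∀ x, ‖(f x : ℂ)‖ ≤ 1 := fun x => by
    rw [norm_ofReal_of_nonneg (hf0 x)]
    exact hf1 x
  have h1 := h v P hP ⊥ (fun q hq hq0 => (hq0 hq).elim) (fun _ => 0) (fun _ => rfl)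
    (fun x => (f x : ℂ)) (fun _ x => (f x : ℂ)) hf fun _ => hf
  have e1 : 𝔼 x, 𝔼 y, config (fun x => (f x : ℂ)) (fun _ x => (f x : ℂ)) v P (fun _ => 0) x y
      = ((𝔼 x, 𝔼 y, f x * ∏ i, f (x + (P i).eval y • v i) : ℝ) : ℂ) := by
    simp [config]
  have e2 : mainTerm (fun x => (f x : ℂ)) (fun _ x => (f x : ℂ)) v
      (fun _ => (0 : Polynomial (ZMod p)))
      = ((𝔼 x, f x * ∏ i, 𝔼 n : ZMod p, f (x + n • v i) : ℝ) : ℂ) := by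
    simp [mainTerm]
  rw [e1, e2, ← ofReal_sub, norm_real, Real.norm_eq_abs] at h1
  have h2 := pow_expect_le_expect_mul_prod_line (p := p) v f hf0
  linarith [(abs_le.mp h1).1]

end Reduction

end PolyConfig

theorem stmt16 (D t : ℕ) (hD : 1 ≤ D) (ht : 1 ≤ t)
    (P : Fin t → Polynomial ℤ)
    (hdeg0 : 0 < (P ⟨0, by omega⟩).natDegree)
    (hmono : ∀ i j : Fin t, i < j → (P i).natDegree < (P j).natDegree)
    (v : Fin t → (Fin D → ℤ)) (hv : ∀ i, v i ≠ 0) :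
    ∃ (c C : ℝ) (p₀ : ℕ), 0 < c ∧
      ∀ (p : ℕ) [Fact p.Prime] [NeZero p], p₀ < p →
      ∀ f : (Fin D → ZMod p) → ℝ, (∀ x, 0 ≤ f x) → (∀ x, f x ≤ 1) →
      (avgR f) ^ (t + 1) - C * (p : ℝ) ^ (-c) ≤
        avgR fun z : (Fin D → ZMod p) × ZMod p =>
          f z.1 * ∏ i : Fin t,
            f (z.1 + ((P i).map (Int.castRingHom (ZMod p))).eval z.2 •
              ((fun j => ((v i j : ℤ) : ZMod p)) : Fin D → ZMod p)) := by
  have hpos : ∀ i, 0 < (P i).natDegree := fun i =>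
    hdeg0.trans_le ((StrictMono.monotone fun i j => hmono i j) (Nat.zero_le i.1))
  obtain ⟨c, C, hc, -, h⟩ := PolyConfig.countBound (univ.sup fun i => (P i).natDegree)
    (fun i => (P i).natDegree) (fun i j => hmono i j) hpos
    fun i => le_sup (f := fun i => (P i).natDegree) (mem_univ i)
  refine ⟨c, C, max (univ.sup fun i => (P i).natDegree)
    (univ.sup fun i => (P i).leadingCoeff.natAbs), hc, fun p _ _ hp f hf0 hf1 => ?_⟩
  rw [max_lt_iff] at hp
  have hdeg : ∀ i, ((P i).map (Int.castRingHom (ZMod p))).natDegree = (P i).natDegree := fun i =>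
    PolyConfig.natDegree_map_intCast (Polynomial.ne_zero_of_natDegree_gt (hpos i))
      ((le_sup (f := fun i => (P i).leadingCoeff.natAbs) (mem_univ i)).trans_lt hp.2)
  rw [PolyConfig.avgR_eq_expect, PolyConfig.avgR_eq_expect, PolyConfig.expect_prod_type]
  exact (h p hp.1 (Fin D → ZMod p)).pow_expect_sub_le _ _ hdeg f hf0 hf1
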